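/- Let ĝ be a lift of a frice homeomorphism g of T², and fix d > 0. Then there exists L_d > 0 such that every stable continuum K̂ ⊂ ℝ² with diam(K̂) ≤ d satisfies diam(ĝ^j(K̂)) ≤ L_d for every integer j > 0. -/

import Mathlib

open Metric Filter Topology MeasureTheory Set ENNReal

noncomputable section

abbrev R2 : Type := ℝ × ℝ

abbrev Torus : Type := AddCircle (1 : ℝ) × AddCircle (1 : ℝ)

instance : Fact ((0:ℝ) < 1) := ⟨one_pos⟩

/-- The covering projection `ℝ² → T²`. -/
def proj : R2 → Torus := fun p => ((p.1 : AddCircle (1:ℝ)), (p.2 : AddCircle (1:ℝ)))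

/-- `F : ℝ² → ℝ²` is a lift of `f : T² → T²` (commutes with the projection and
with the integer translations). -/
def IsLiftFun (f : Torus → Torus) (F : R2 → R2) : Prop :=
  (∀ x : R2, proj (F x) = f (proj x)) ∧
  ∀ (x : R2) (v : ℤ × ℤ), F (x + ((v.1 : ℝ), (v.2 : ℝ))) = F x + ((v.1 : ℝ), (v.2 : ℝ))

/-- Iteration of a homeomorphism indexed by `ℤ`. -/
def iterZ {X : Type*} [TopologicalSpace X] (F : X ≃ₜ X) : ℤ → X → X
  | Int.ofNat n => (⇑F)^[n]
  | Int.negSucc n => (⇑F.symm)^[n+1]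

/-- The rotation set of a lift. -/
def rotSet (F : R2 ≃ₜ R2) : Set R2 :=
  {v | ∃ (z : ℕ → R2) (n : ℕ → ℕ), Tendsto n atTop atTop ∧
    Tendsto (fun k => ((n k : ℝ))⁻¹ • ((⇑F)^[n k] (z k) - z k)) atTop (nhds v)}

/-- A continuum: a nonempty compact connected set. -/
def IsContinuum {X : Type*} [TopologicalSpace X] (K : Set X) : Prop :=
  IsCompact K ∧ IsConnected K

/-- Dynamical diameter of a set under a homeomorphism of the plane. -/
def dynDiam (F : R2 ≃ₜ R2) (K : Set R2) : ℝ≥0∞ :=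
  ⨆ j : ℤ, EMetric.diam (iterZ F j '' K)

/-- Topological mixing. -/
def TopologicallyMixing {X : Type*} [TopologicalSpace X] (h : X → X) : Prop :=
  ∀ U V : Set X, IsOpen U → IsOpen V → U.Nonempty → V.Nonempty →
    ∃ n₀ : ℕ, ∀ n, n₀ ≤ n → ((h^[n]) '' U ∩ V).Nonempty

/-- Maximal cardinality of a `(±n, ε)`-separated subset of `K`. -/
def sepCount (g : Torus ≃ₜ Torus) (n : ℕ) (ε : ℝ) (K : Set Torus) : ℕ :=
  sSup {m : ℕ | ∃ Y : Finset Torus, ↑Y ⊆ K ∧ Y.card = m ∧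
    ∀ y ∈ Y, ∀ y' ∈ Y, y ≠ y' →
      ∃ i : ℤ, |i| ≤ (n : ℤ) ∧ ε < dist (iterZ g i y) (iterZ g i y')}

/-- The two-sided entropy `h_±(g, K)` carried by `K`. -/
def entropyPM (g : Torus ≃ₜ Torus) (K : Set Torus) : EReal :=
  ⨆ (ε : ℝ) (_ : 0 < ε),
    limsup (fun n : ℕ => ((Real.log (sepCount g n ε K) / n : ℝ) : EReal)) atTop

/-- Connected component of the `ε`-stable set of `z` containing `z`. -/
def stableComp (G : R2 ≃ₜ R2) (ε : ℝ) (z : R2) : Set R2 :=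
  connectedComponentIn {z' : R2 | ∀ j : ℕ, dist ((⇑G)^[j] z') ((⇑G)^[j] z) ≤ ε} z

/-- The stable set of `z`. -/
def stableSet (G : R2 ≃ₜ R2) (z : R2) : Set R2 := ⋃ ε > 0, stableComp G ε z

/-- Connected component of the `ε`-unstable set of `z` containing `z`. -/
def unstableComp (G : R2 ≃ₜ R2) (ε : ℝ) (z : R2) : Set R2 :=
  connectedComponentIn {z' : R2 | ∀ j : ℕ, dist ((⇑G.symm)^[j] z') ((⇑G.symm)^[j] z) ≤ ε} z

/-- The unstable set of `z`. -/
def unstableSet (G : R2 ≃ₜ R2) (z : R2) : Set R2 := ⋃ ε > 0, unstableComp G ε z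

/-- Two points are dynamically related if some dynamically bounded continuum contains both. -/
def dynRel (F : R2 ≃ₜ R2) (z z' : R2) : Prop :=
  ∃ K : Set R2, IsContinuum K ∧ z ∈ K ∧ z' ∈ K ∧ dynDiam F K ≠ ⊤

/-- The equivalence class of `z` under the dynamically-bounded relation. -/
def dynClass (F : R2 ≃ₜ R2) (z : R2) : Set R2 := {z' | dynRel F z z'}



/-! ### Poincaré–Miranda -/

lemma pm_arg (w : ℂ) (hw : w ≠ 0) (h : 0 ≤ w.re) :
    (Complex.I * w).arg = w.arg + Real.pi / 2 := by
  have h1 := abs_le.1 (Complex.abs_arg_le_pi_div_two_iff.2 h)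
  have := (Complex.arg_mul_eq_add_arg_iff Complex.I_ne_zero hw).2 (by
    rw [Complex.arg_I]
    constructor <;> linarith [Real.pi_pos])
  rw [this, Complex.arg_I, add_comm]

lemma pm_side (L : ℝ → ℂ) (hL : Continuous L) (c : ℂ) (hc : c ≠ 0)
    (h : ∀ t, 0 ≤ (c * Complex.exp (L t)).re) (s t : ℝ) :
    (L t).im - (L s).im = (c * Complex.exp (L t)).arg - (c * Complex.exp (L s)).arg := by
  have hne : ∀ t, c * Complex.exp (L t) ≠ 0 := fun t => mul_ne_zero hc (Complex.exp_ne_zero _)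
  have hsl : ∀ t, c * Complex.exp (L t) ∈ Complex.slitPlane := by
    intro t
    rw [Complex.mem_slitPlane_iff]
    rcases (h t).lt_or_eq with h1 | h1
    · exact Or.inl h1
    · right
      intro h2
      exact hne t (Complex.ext h1.symm h2)
  have hcont : Continuous fun t => L t - Complex.log (c * Complex.exp (L t)) := by
    refine hL.sub ?_
    exact Continuous.clog (by fun_prop) hsl
  have hconst := Complex.isCoveringMap_exp.const_of_comp hcont (by
    intro a a'
    apply Subtype.ext
    simp only [Complex.exp_sub, Complex.exp_log (hne _)]
    have := Complex.exp_ne_zero (L a)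
    have := Complex.exp_ne_zero (L a')
    field_simp) s t
  have := congrArg Complex.im hconst
  simp only [Complex.sub_im, Complex.log_im] at this
  linarith

lemma pm_global (f g : ℝ × ℝ → ℝ) (hf : Continuous f) (hg : Continuous g) (a b c d : ℝ)
    (hl : ∀ t, f (a, t) ≤ 0) (hr : ∀ t, 0 ≤ f (b, t))
    (hb : ∀ t, g (t, c) ≤ 0) (ht : ∀ t, 0 ≤ g (t, d)) : ∃ p, f p = 0 ∧ g p = 0 := by
  by_contra! hno
  let F : ℝ × ℝ → ℂ := fun p => ⟨f p, g p⟩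
  have hF : Continuous F := by
    have : F = fun p => (f p : ℂ) + (g p : ℂ) * Complex.I := by
      ext p; exact Complex.mk_eq_add_mul_I _ _
    rw [this]; fun_prop
  have hF0 : ∀ p, F p ≠ 0 := by
    intro p hp
    exact hno p (congrArg Complex.re hp) (congrArg Complex.im hp)
  let F' : C(ℝ × ℝ, {z : ℂ // z ≠ 0}) := ⟨fun p => ⟨F p, hF0 p⟩, by fun_prop⟩
  obtain ⟨L, ⟨_, hL⟩, -⟩ := Complex.isCoveringMap_exp.existsUnique_continuousMap_lifts F' (a, c)
    (Complex.log (F (a, c))) (Subtype.ext (Complex.exp_log (hF0 _)))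
  have hLF : ∀ p, Complex.exp (L p) = F p := fun p => congrArg Subtype.val (congrFun hL p)
  have hLc := L.continuous
  have s1 := pm_side (fun t => L (t, c)) (by fun_prop) Complex.I Complex.I_ne_zero
    (by intro t; rw [hLF]; simpa [F] using hb t) a b
  have s2 := pm_side (fun t => L (b, t)) (by fun_prop) 1 one_ne_zero
    (by intro t; rw [hLF]; simpa [F] using hr t) c d
  have s3 := pm_side (fun t => L (t, d)) (by fun_prop) (-Complex.I) (neg_ne_zero.2 Complex.I_ne_zero)
    (by intro t; rw [hLF]; simpa [F] using ht t) b a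
  have s4 := pm_side (fun t => L (a, t)) (by fun_prop) (-1) (by simp)
    (by intro t; rw [hLF]; simpa [F] using hl t) d c
  simp only [hLF] at s1 s2 s3 s4
  have c1 := pm_arg (1 * F (b, c)) (by simpa using hF0 _) (by simpa [F] using hr c)
  have c2 := pm_arg (-Complex.I * F (b, d)) (by simpa using hF0 _) (by simpa [F] using ht b)
  have c3 := pm_arg (-1 * F (a, d)) (by simpa using hF0 _) (by simpa [F] using hl d)
  have c4 := pm_arg (Complex.I * F (a, c)) (by simpa using hF0 _) (by simpa [F] using hb a)
  have e1 : Complex.I * (1 * F (b, c)) = Complex.I * F (b, c) := by ring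
  have e2 : Complex.I * (-Complex.I * F (b, d)) = 1 * F (b, d) := by
    linear_combination (-F (b,d)) * Complex.I_mul_I
  have e3 : Complex.I * (-1 * F (a, d)) = -Complex.I * F (a, d) := by ring
  have e4 : Complex.I * (Complex.I * F (a, c)) = -1 * F (a, c) := by
    linear_combination (F (a,c)) * Complex.I_mul_I
  rw [e1] at c1
  rw [e2] at c2
  rw [e3] at c3
  rw [e4] at c4
  linarith [Real.pi_pos]

/-- clamping to an interval -/
def clampI (a b : ℝ) (x : ℝ) : ℝ := max a (min b x)

lemma clampI_cont (a b : ℝ) : Continuous (clampI a b) := by unfold clampI; fun_prop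

lemma clampI_mem {a b : ℝ} (h : a ≤ b) (x : ℝ) : clampI a b x ∈ Icc a b := by
  unfold clampI; constructor <;> simp [h]

lemma clampI_of_mem {a b x : ℝ} (h : x ∈ Icc a b) : clampI a b x = x := by
  unfold clampI; simp [h.1, h.2]

/-- closed rectangle -/
def Rect (a b c d : ℝ) : Set R2 := Icc a b ×ˢ Icc c d

def clampR (a b c d : ℝ) (p : R2) : R2 := (clampI a b p.1, clampI c d p.2)

lemma clampR_cont (a b c d : ℝ) : Continuous (clampR a b c d) := by
  have := clampI_cont a b
  have := clampI_cont c d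
  unfold clampR; fun_prop

lemma clampR_mem {a b c d : ℝ} (h : a ≤ b) (h' : c ≤ d) (p : R2) :
    clampR a b c d p ∈ Rect a b c d := ⟨clampI_mem h _, clampI_mem h' _⟩

lemma clampR_of_mem {a b c d : ℝ} {p : R2} (h : p ∈ Rect a b c d) : clampR a b c d p = p :=
  Prod.ext (clampI_of_mem h.1) (clampI_of_mem h.2)

lemma pm_rect (f g : R2 → ℝ) (a b c d : ℝ) (hab : a ≤ b) (hcd : c ≤ d)
    (hf : ContinuousOn f (Rect a b c d)) (hg : ContinuousOn g (Rect a b c d))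
    (hl : ∀ t ∈ Icc c d, f (a, t) ≤ 0) (hr : ∀ t ∈ Icc c d, 0 ≤ f (b, t))
    (hb : ∀ t ∈ Icc a b, g (t, c) ≤ 0) (ht : ∀ t ∈ Icc a b, 0 ≤ g (t, d)) :
    ∃ p ∈ Rect a b c d, f p = 0 ∧ g p = 0 := by
  have hm := fun p => clampR_mem hab hcd p
  obtain ⟨p, h1, h2⟩ := pm_global (f ∘ clampR a b c d) (g ∘ clampR a b c d)
    (hf.comp_continuous (clampR_cont a b c d) hm) (hg.comp_continuous (clampR_cont a b c d) hm)
    a b c d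
    (by intro t; simpa [clampR, clampI_of_mem (left_mem_Icc.2 hab)] using hl _ (clampI_mem hcd t))
    (by intro t; simpa [clampR, clampI_of_mem (right_mem_Icc.2 hab)] using hr _ (clampI_mem hcd t))
    (by intro t; simpa [clampR, clampI_of_mem (left_mem_Icc.2 hcd)] using hb _ (clampI_mem hab t))
    (by intro t; simpa [clampR, clampI_of_mem (right_mem_Icc.2 hcd)] using ht _ (clampI_mem hab t))
  exact ⟨_, hm p, h1, h2⟩


/-! ### Continua -/

lemma IsContinuum.isCompact' {X : Type*} [TopologicalSpace X] {A : Set X} (h : IsContinuum A) : IsCompact A := h.1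
lemma IsContinuum.image {X Y : Type*} [TopologicalSpace X] [TopologicalSpace Y] {A : Set X}
    (h : IsContinuum A) {f : X → Y} (hf : Continuous f) : IsContinuum (f '' A) :=
  ⟨h.1.image hf, h.2.image f hf.continuousOn⟩

lemma clopen_sep {Z : Type*} [TopologicalSpace Z] [CompactSpace Z] [T2Space Z] (A B : Set Z)
    (hA : IsClosed A) (hB : IsClosed B)
    (h : ∀ x ∈ A, Disjoint (connectedComponent x) B) :
    ∃ W : Set Z, IsClopen W ∧ A ⊆ W ∧ Disjoint W B := by
  refine hA.isCompact.induction_on (p := fun S => ∃ W : Set Z, IsClopen W ∧ S ⊆ W ∧ Disjoint W B)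
    ⟨∅, isClopen_empty, by simp, by simp⟩ ?_ ?_ ?_
  · rintro s t hst ⟨W, h1, h2, h3⟩
    exact ⟨W, h1, hst.trans h2, h3⟩
  · rintro s t ⟨W, h1, h2, h3⟩ ⟨W', h1', h2', h3'⟩
    exact ⟨W ∪ W', h1.union h1', union_subset_union h2 h2', Disjoint.union_left h3 h3'⟩
  · intro x hx
    have hd := h x hx
    rw [connectedComponent_eq_iInter_isClopen] at hd
    have hne : Nonempty { s : Set Z // IsClopen s ∧ x ∈ s } := ⟨⟨univ, isClopen_univ, trivial⟩⟩
    obtain ⟨⟨s, hs, hxs⟩, h2⟩ := hB.isCompact.elim_directed_family_closed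
      (fun s : { s : Set Z // IsClopen s ∧ x ∈ s } => (s : Set Z))
      (fun s => s.2.1.isClosed) (by
        rw [← disjoint_iff_inter_eq_empty]; exact hd.symm) (by
        rintro ⟨s, hs, hxs⟩ ⟨t, ht, hxt⟩
        exact ⟨⟨s ∩ t, hs.inter ht, hxs, hxt⟩, inter_subset_left, inter_subset_right⟩)

    refine ⟨s, mem_nhdsWithin_of_mem_nhds (hs.isOpen.mem_nhds hxs), s, hs, subset_rfl, ?_⟩
    exact (disjoint_iff_inter_eq_empty.2 h2).symm

lemma cut {X : Type*} [TopologicalSpace X] [T2Space X] {A : Set X} (hA : IsContinuum A) (f : X → ℝ) (hf : Continuous f) {α β : ℝ}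
    (hαβ : α < β) (hx : ∃ x ∈ A, f x ≤ α) (hy : ∃ y ∈ A, β ≤ f y) :
    ∃ C ⊆ A, IsContinuum C ∧ (∀ x ∈ C, α ≤ f x ∧ f x ≤ β) ∧ (∃ x ∈ C, f x = α) ∧
      ∃ y ∈ C, f y = β := by
  by_contra hno
  let Z := A ∩ f ⁻¹' Icc α β
  have hZ : IsCompact Z := hA.1.inter_right (isClosed_Icc.preimage hf)
  have : CompactSpace Z := isCompact_iff_compactSpace.1 hZ
  obtain ⟨W, hW, hW1, hW2⟩ := clopen_sep {z : Z | f z = α} {z : Z | f z = β}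
    (isClosed_eq (by fun_prop) (by fun_prop)) (isClosed_eq (by fun_prop) (by fun_prop)) (by
    intro x hx
    rw [disjoint_left]
    intro y hy hyb
    apply hno
    refine ⟨Subtype.val '' connectedComponent x, ?_, ?_, ?_, ⟨x, ⟨x, mem_connectedComponent, rfl⟩, hx⟩,
      ⟨y, ⟨y, hy, rfl⟩, hyb⟩⟩
    · rintro _ ⟨z, -, rfl⟩; exact z.2.1
    · refine IsContinuum.image ⟨isClosed_connectedComponent.isCompact, isConnected_connectedComponent⟩ continuous_subtype_val
    · rintro _ ⟨z, -, rfl⟩; exact z.2.2)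
  have hc1 : IsClosed (A ∩ f ⁻¹' Iic α ∪ Subtype.val '' W) :=
    ((hA.1.inter_right (isClosed_Iic.preimage hf)).union
      (hW.isClosed.isCompact.image continuous_subtype_val)).isClosed
  have hc2 : IsClosed (A ∩ f ⁻¹' Ici β ∪ Subtype.val '' Wᶜ) :=
    ((hA.1.inter_right (isClosed_Ici.preimage hf)).union
      (hW.compl.isClosed.isCompact.image continuous_subtype_val)).isClosed
  obtain ⟨x, hxA, hx⟩ := hx
  obtain ⟨y, hyA, hy⟩ := hy
  obtain ⟨w, hwA, hw1, hw2⟩ := isPreconnected_closed_iff.1 hA.2.isPreconnected _ _ hc1 hc2 (by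
    intro w hw
    rcases le_total (f w) α with h1 | h1
    · exact Or.inl (Or.inl ⟨hw, h1⟩)
    rcases le_total β (f w) with h2 | h2
    · exact Or.inr (Or.inl ⟨hw, h2⟩)
    by_cases h3 : (⟨w, hw, h1, h2⟩ : Z) ∈ W
    · exact Or.inl (Or.inr ⟨_, h3, rfl⟩)
    · exact Or.inr (Or.inr ⟨_, h3, rfl⟩)) ⟨x, hxA, Or.inl ⟨hxA, hx⟩⟩ ⟨y, hyA, Or.inl ⟨hyA, hy⟩⟩
  rcases hw1 with ⟨-, h1⟩ | ⟨z, hz, rfl⟩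
  · rcases hw2 with ⟨-, h2⟩ | ⟨z, hz, rfl⟩
    · simp only [mem_preimage, mem_Iic, mem_Ici] at h1 h2; linarith
    · exact hz (hW1 (le_antisymm h1 z.2.2.1))
  · rcases hw2 with ⟨-, h2⟩ | ⟨z', hz', hzz⟩
    · exact disjoint_left.1 hW2 hz (le_antisymm z.2.2.2 h2)
    · rw [Subtype.ext hzz] at hz'; exact hz' hz

/-- boundary bumping -/
lemma cut_ball {X : Type*} [MetricSpace X] {A : Set X} (hA : IsContinuum A) {x : X} (hx : x ∈ A) {r : ℝ} (hr : 0 < r)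
    (hy : ∃ y ∈ A, r ≤ dist y x) :
    ∃ C ⊆ A, IsContinuum C ∧ x ∈ C ∧ C ⊆ closedBall x r ∧ ∃ y ∈ C, dist y x = r := by
  obtain ⟨C, h1, h2, h3, ⟨x', h4, h4'⟩, h5⟩ := cut hA (fun y => dist y x) (by fun_prop) hr
    ⟨x, hx, by simp⟩ hy
  rw [dist_eq_zero] at h4'
  subst h4'
  exact ⟨C, h1, h2, h4, fun y hy => (h3 y hy).2, h5⟩

def DiamLE {X : Type*} [PseudoMetricSpace X] (S : Set X) (c : ℝ) : Prop := ∀ x ∈ S, ∀ y ∈ S, dist x y ≤ c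
def DiamGE {X : Type*} [PseudoMetricSpace X] (S : Set X) (c : ℝ) : Prop := ∃ x ∈ S, ∃ y ∈ S, c ≤ dist x y

lemma DiamLE.mono {X : Type*} [PseudoMetricSpace X] {S T : Set X} {c c' : ℝ} (h : DiamLE T c) (hS : S ⊆ T) (hc : c ≤ c') :
    DiamLE S c' := fun x hx y hy => (h x (hS hx) y (hS hy)).trans hc

lemma DiamGE.mono {X : Type*} [PseudoMetricSpace X] {S T : Set X} {c c' : ℝ} (h : DiamGE S c) (hS : S ⊆ T) (hc : c' ≤ c) :
    DiamGE T c' := by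
  obtain ⟨x, hx, y, hy, h⟩ := h
  exact ⟨x, hS hx, y, hS hy, hc.trans h⟩

lemma not_diamLE {X : Type*} [PseudoMetricSpace X] {S : Set X} {c : ℝ} (h : ¬ DiamLE S c) : ∃ x ∈ S, ∃ y ∈ S, c < dist x y := by
  unfold DiamLE at h; push Not at h; exact h

lemma not_diamLE_GE {X : Type*} [PseudoMetricSpace X] {S : Set X} {c : ℝ} (h : ¬ DiamLE S c) : DiamGE S c := by
  obtain ⟨x, hx, y, hy, h⟩ := not_diamLE h; exact ⟨x, hx, y, hy, h.le⟩

lemma DiamGE.far {X : Type*} [PseudoMetricSpace X] {S : Set X} {c : ℝ} (h : DiamGE S c) (x : X) : ∃ y ∈ S, c / 2 ≤ dist y x := by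
  obtain ⟨a, ha, b, hb, h⟩ := h
  by_contra! hno
  have := hno a ha
  have := hno b hb
  have := dist_triangle_right a b x
  linarith

lemma diamLE_closedBall {X : Type*} [PseudoMetricSpace X] {x : X} {r : ℝ} : DiamLE (closedBall x r) (2 * r) := by
  intro a ha b hb
  rw [mem_closedBall] at ha hb
  have := dist_triangle_right a b x
  linarith

/-- Cut a continuum of diameter at least twice r at x. -/
lemma cut_piece {X : Type*} [MetricSpace X] {A : Set X} (hA : IsContinuum A) {x : X} (hx : x ∈ A) {r : ℝ} (hr : 0 < r)
    (hd : DiamGE A (2 * r)) :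
    ∃ C ⊆ A, IsContinuum C ∧ x ∈ C ∧ C ⊆ closedBall x r ∧ DiamGE C r := by
  obtain ⟨y, hy, h⟩ := hd.far x
  obtain ⟨C, h1, h2, h3, h4, y, hy, h5⟩ := cut_ball hA hx hr ⟨y, hy, by linarith⟩
  exact ⟨C, h1, h2, h3, h4, y, hy, x, h3, h5.ge⟩


/-! ### Hex -/

lemma path_in_component {Ω : Set R2} (hΩ : IsOpen Ω) {S : Set R2} (hS : IsPreconnected S) (hSΩ : S ⊆ Ω)
    {x y : R2} (hx : x ∈ S) (hy : y ∈ S) : ∃ γ : Path x y, ∀ t, γ t ∈ Ω := by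
  have h1 : IsOpen (connectedComponentIn Ω x) := hΩ.connectedComponentIn
  have h2 : IsConnected (connectedComponentIn Ω x) := isConnected_connectedComponentIn_iff.2 (hSΩ hx)
  have h3 : S ⊆ connectedComponentIn Ω x := hS.subset_connectedComponentIn hx hSΩ
  have h4 := (h1.isConnected_iff_isPathConnected).1 h2
  obtain ⟨γ, hγ⟩ := h4.joinedIn x (h3 hx) y (h3 hy)
  exact ⟨γ, fun t => connectedComponentIn_subset _ _ (hγ t)⟩

lemma hex {a b c d : ℝ} (hab : a ≤ b) (hcd : c ≤ d) {P : Set R2} (hP : IsContinuum P)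
    (hPs : P ⊆ Rect a b c d) (hL : ∃ p ∈ P, p.1 = a) (hR : ∃ p ∈ P, p.1 = b) (x0 x1 : ℝ) :
    (x1, d) ∉ connectedComponentIn (Rect a b c d \ P) (x0, c) := by
  intro hmem
  have hx0 : (x0, c) ∈ Rect a b c d \ P := by
    by_contra h
    rw [connectedComponentIn_eq_empty h] at hmem
    exact hmem
  have hx1 := connectedComponentIn_subset _ _ hmem
  have hcl := clampR_cont a b c d
  have hΩ : IsOpen (clampR a b c d ⁻¹' Pᶜ) := hP.1.isClosed.isOpen_compl.preimage hcl
  obtain ⟨γ, hγ⟩ := path_in_component hΩ isPreconnected_connectedComponentIn (by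
    intro y hy
    have := connectedComponentIn_subset _ _ hy
    rw [mem_preimage, clampR_of_mem this.1]
    exact this.2) (mem_connectedComponentIn hx0) hmem
  let C : ℝ → R2 := fun t => clampR a b c d (γ.extend t)
  have hγc : Continuous γ.extend := γ.continuous_extend
  have hC : Continuous C := hcl.comp hγc
  have hCr : ∀ t, C t ∈ Rect a b c d := fun t => clampR_mem hab hcd _
  have hCP : ∀ t, C t ∉ P := by
    intro t
    have : γ.extend t ∈ range γ.extend := ⟨t, rfl⟩
    rw [Path.extend_range] at this
    obtain ⟨s, hs⟩ := this
    have := hγ s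
    rw [hs] at this
    exact this
  have hCrange : IsClosed (range C) := by
    have : range C = clampR a b c d '' range γ := by
      rw [← Path.extend_range, ← range_comp]; rfl
    rw [this]
    exact ((isCompact_range γ.continuous).image hcl).isClosed
  obtain ⟨pL, hpL, hpL1⟩ := hL
  obtain ⟨pR, hpR, hpR1⟩ := hR
  obtain ⟨σ, hσ⟩ := path_in_component (hCrange.isOpen_compl.preimage hcl) hP.2.isPreconnected (by
    intro y hy
    rw [mem_preimage, clampR_of_mem (hPs hy)]
    rintro ⟨t, rfl⟩
    exact hCP t hy) hpL hpR
  let Q : ℝ → R2 := fun t => clampR a b c d (σ.extend t)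
  have hσc : Continuous σ.extend := σ.continuous_extend
  have hQ : Continuous Q := hcl.comp hσc
  have hQr : ∀ t, Q t ∈ Rect a b c d := fun t => clampR_mem hab hcd _
  have hQC : ∀ t s, Q t ≠ C s := by
    intro t s' heq
    have : σ.extend t ∈ range σ.extend := ⟨t, rfl⟩
    rw [Path.extend_range] at this
    obtain ⟨s, hs⟩ := this
    have := hσ s
    rw [hs] at this
    exact this ⟨s', heq.symm⟩
  have hQ0 : (Q 0).1 = a := by
    simp only [Q, Path.extend_zero, clampR_of_mem (hPs hpL), hpL1]
  have hQ1 : (Q 1).1 = b := by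
    simp only [Q, Path.extend_one, clampR_of_mem (hPs hpR), hpR1]
  have hC0 : (C 0).2 = c := by
    simp only [C, Path.extend_zero, clampR_of_mem hx0.1]
  have hC1 : (C 1).2 = d := by
    simp only [C, Path.extend_one, clampR_of_mem hx1.1]
  obtain ⟨p, h1, h2⟩ := pm_global (fun p => (Q p.1).1 - (C p.2).1) (fun p => (C p.2).2 - (Q p.1).2)
    (by fun_prop) (by fun_prop) 0 1 0 1
    (by intro t; simp only [hQ0]; have := (hCr t).1.1; linarith)
    (by intro t; simp only [hQ1]; have := (hCr t).1.2; linarith)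
    (by intro t; simp only [hC0]; have := (hQr t).2.1; linarith)
    (by intro t; simp only [hC1]; have := (hQr t).2.2; linarith)
  exact hQC p.1 p.2 (Prod.ext (by linarith) (by linarith))


/-! ### The planar lemma -/

def Dn (a b c d : ℝ) (P : Set R2) : Set R2 := connectedComponentIn (Rect a b c d \ P) (a, c)

structure Cross (a b c d : ℝ) (P : Set R2) : Prop where
  cont : IsContinuum P
  sub : P ⊆ Rect a b c d
  mid : ∀ p ∈ P, c < p.2 ∧ p.2 < d
  left : ∃ p ∈ P, p.1 = a
  right : ∃ p ∈ P, p.1 = b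

lemma rect_convex (a b c d : ℝ) : Convex ℝ (Rect a b c d) := (convex_Icc a b).prod (convex_Icc c d)
lemma rect_compact (a b c d : ℝ) : IsCompact (Rect a b c d) := isCompact_Icc.prod isCompact_Icc

/-- component saturation -/
lemma comp_sat {F S : Set R2} {x : R2} (hS : IsPreconnected S) (hSF : S ⊆ F)
    (h : (S ∩ connectedComponentIn F x).Nonempty) : S ⊆ connectedComponentIn F x := by
  obtain ⟨y, hy, hyx⟩ := h
  rw [connectedComponentIn_eq hyx]
  exact hS.subset_connectedComponentIn hy hSF

lemma Dn_bot {a b c d : ℝ} (hab : a ≤ b) (hcd : c ≤ d) {P : Set R2} (hP : Cross a b c d P) {x : ℝ} (hx : x ∈ Icc a b) :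
    (x, c) ∈ Dn a b c d P := by
  have hpre : IsPreconnected (Icc a b ×ˢ ({c} : Set ℝ)) :=
    ((convex_Icc a b).prod (convex_singleton c)).isPreconnected
  have := hpre.subset_connectedComponentIn (x := (a, c)) (F := Rect a b c d \ P)
    ⟨left_mem_Icc.2 hab, rfl⟩ (by
      rintro ⟨u, v⟩ ⟨hu, hv⟩
      simp only [mem_singleton_iff] at hv
      subst hv
      refine ⟨⟨hu, left_mem_Icc.2 hcd⟩, fun hp => ?_⟩
      exact lt_irrefl _ (hP.mid _ hp).1)
  exact this ⟨hx, rfl⟩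

lemma Dn_top {a b c d : ℝ} (hab : a ≤ b) (hcd : c ≤ d) {P : Set R2} (hP : Cross a b c d P) (x : ℝ) :
    (x, d) ∉ Dn a b c d P := hex hab hcd hP.cont hP.sub hP.left hP.right a x

lemma locconst {Sg : Set R2} (hSg : Convex ℝ Sg) {P P' : Set R2} (hP : IsClosed P) (hP' : IsClosed P')
    (hdis : Disjoint P P') {O : Set R2}
    (hO : ∀ S ⊆ Sg \ P, IsPreconnected S → (S ∩ O).Nonempty → S ⊆ O)
    (hO' : ∀ S ⊆ Sg \ P', IsPreconnected S → (S ∩ O).Nonempty → S ⊆ O)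
    (hne : (Sg ∩ O).Nonempty) : Sg ⊆ O := by
  by_contra hno
  rw [not_subset] at hno
  obtain ⟨z, hz, hzO⟩ := hno
  obtain ⟨x, hx, hxO⟩ := hne
  have key : ∀ y ∈ Sg, ∃ r > 0, (Sg ∩ ball y r ⊆ O) ∨ (Disjoint (Sg ∩ ball y r) O) := by
    have aux : ∀ Q : Set R2, IsClosed Q → (∀ S ⊆ Sg \ Q, IsPreconnected S → (S ∩ O).Nonempty → S ⊆ O) →
        ∀ y, y ∉ Q → ∃ r > 0, (Sg ∩ ball y r ⊆ O) ∨ (Disjoint (Sg ∩ ball y r) O) := by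
      intro Q hQ hsat y hy
      obtain ⟨r, hr, hb⟩ := Metric.isOpen_iff.1 hQ.isOpen_compl y hy
      refine ⟨r, hr, ?_⟩
      by_cases h : ((Sg ∩ ball y r) ∩ O).Nonempty
      · left
        exact hsat _ (fun w hw => ⟨hw.1, hb hw.2⟩) (hSg.inter (convex_ball y r)).isPreconnected h
      · right
        rwa [disjoint_iff_inter_eq_empty, ← not_nonempty_iff_eq_empty]
    intro y hy
    by_cases hyP : y ∈ P
    · exact aux P' hP' hO' y (disjoint_left.1 hdis hyP)
    · exact aux P hP hO y hyP
  let U : Set R2 := ⋃₀ {B | IsOpen B ∧ Sg ∩ B ⊆ O}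
  let V : Set R2 := ⋃₀ {B | IsOpen B ∧ Disjoint (Sg ∩ B) O}
  have hU : IsOpen U := isOpen_sUnion fun B hB => hB.1
  have hV : IsOpen V := isOpen_sUnion fun B hB => hB.1
  have hcov : ∀ y ∈ Sg, (y ∈ O → y ∈ U) ∧ (y ∉ O → y ∈ V) := by
    intro y hy
    obtain ⟨r, hr, h | h⟩ := key y hy
    · exact ⟨fun _ => ⟨_, ⟨isOpen_ball, h⟩, mem_ball_self hr⟩, fun hn => absurd (h ⟨hy, mem_ball_self hr⟩) hn⟩
    · exact ⟨fun hyO => absurd hyO (disjoint_left.1 h ⟨hy, mem_ball_self hr⟩),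
        fun _ => ⟨_, ⟨isOpen_ball, h⟩, mem_ball_self hr⟩⟩
  obtain ⟨w, hw, ⟨B, hB, hwB⟩, ⟨B', hB', hwB'⟩⟩ := hSg.isPreconnected U V hU hV (by
    intro y hy
    by_cases h : y ∈ O
    · exact Or.inl ((hcov y hy).1 h)
    · exact Or.inr ((hcov y hy).2 h)) ⟨x, hx, (hcov x hx).1 hxO⟩ ⟨z, hz, (hcov z hz).2 hzO⟩
  exact disjoint_left.1 hB'.2 ⟨hw, hwB'⟩ (hB.2 ⟨hw, hwB⟩)

lemma Dn_order {a b c d : ℝ} (hab : a ≤ b) (hcd : c ≤ d) {P P' : Set R2} (hP : Cross a b c d P)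
    (hP' : Cross a b c d P') (hdis : Disjoint P P') :
    Disjoint P' (Dn a b c d P) ∨ Disjoint P (Dn a b c d P') := by
  by_contra! hno
  obtain ⟨h1, h2⟩ := hno
  rw [not_disjoint_iff_nonempty_inter] at h1 h2
  have hs1 : P' ⊆ Dn a b c d P := comp_sat hP'.cont.2.isPreconnected
    (fun p hp => ⟨hP'.sub hp, disjoint_right.1 hdis hp⟩) h1
  have hs2 : P ⊆ Dn a b c d P' := comp_sat hP.cont.2.isPreconnected
    (fun p hp => ⟨hP.sub hp, disjoint_left.1 hdis hp⟩) h2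
  -- top components
  have htop : ∀ Q, Cross a b c d Q → (a, d) ∈ Rect a b c d \ Q := by
    intro Q hQ
    exact ⟨⟨left_mem_Icc.2 hab, right_mem_Icc.2 hcd⟩, fun hp => lt_irrefl _ (hQ.mid _ hp).2⟩
  have hdisT : ∀ Q, Cross a b c d Q →
      Disjoint (connectedComponentIn (Rect a b c d \ Q) (a, d)) (Dn a b c d Q) := by
    intro Q hQ
    rw [disjoint_left]
    intro w hw hw'
    have e1 := connectedComponentIn_eq hw
    have e2 := connectedComponentIn_eq hw'
    apply Dn_top hab hcd hQ a
    have : (a, d) ∈ connectedComponentIn (Rect a b c d \ Q) (a, d) := mem_connectedComponentIn (htop Q hQ)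
    rw [e1, ← e2] at this
    exact this
  have incl : ∀ Q Q', Cross a b c d Q → Cross a b c d Q' → Q' ⊆ Dn a b c d Q →
      connectedComponentIn (Rect a b c d \ Q) (a, d) ⊆ connectedComponentIn (Rect a b c d \ Q') (a, d) := by
    intro Q Q' hQ hQ' hs
    refine comp_sat isPreconnected_connectedComponentIn (fun w hw => ?_)
      ⟨(a, d), mem_connectedComponentIn (htop Q hQ), mem_connectedComponentIn (htop Q' hQ')⟩
    refine ⟨(connectedComponentIn_subset _ _ hw).1, fun hwQ => ?_⟩
    exact disjoint_left.1 (hdisT Q hQ) hw (hs hwQ)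
  have heq := (incl P P' hP hP' hs1).antisymm (incl P' P hP' hP hs2)
  have := locconst (rect_convex a b c d) hP.cont.1.isClosed hP'.cont.1.isClosed hdis
    (O := connectedComponentIn (Rect a b c d \ P) (a, d))
    (fun S hS hpre hne => comp_sat hpre hS hne)
    (fun S hS hpre hne => by rw [heq] at hne ⊢; exact comp_sat hpre hS hne)
    ⟨(a, d), (htop P hP).1, mem_connectedComponentIn (htop P hP)⟩
  refine disjoint_left.1 (hdisT P hP) (this (a := (a, c)) ⟨left_mem_Icc.2 hab, left_mem_Icc.2 hcd⟩) ?_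
  exact Dn_bot hab hcd hP (left_mem_Icc.2 hab)

lemma Dn_sub {a b c d : ℝ} (hab : a ≤ b) (hcd : c ≤ d) {P P' : Set R2} (hP : Cross a b c d P)
    (hP' : Cross a b c d P') (h : Disjoint P' (Dn a b c d P)) : Dn a b c d P ⊆ Dn a b c d P' := by
  refine comp_sat isPreconnected_connectedComponentIn (fun w hw => ?_) ⟨(a, c), ?_, ?_⟩
  · exact ⟨(connectedComponentIn_subset _ _ hw).1, fun hwQ => disjoint_left.1 h hwQ hw⟩
  · exact Dn_bot hab hcd hP (left_mem_Icc.2 hab)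
  · exact Dn_bot hab hcd hP' (left_mem_Icc.2 hab)

lemma Dn_sub2 {a b c d : ℝ} (hab : a ≤ b) (hcd : c ≤ d) {P P' : Set R2} (hP : Cross a b c d P)
    (hP' : Cross a b c d P') (hdis : Disjoint P P') (h : Disjoint P' (Dn a b c d P)) :
    P ⊆ Dn a b c d P' := by
  by_contra hno
  have h2 : Disjoint P (Dn a b c d P') := by
    by_contra h3
    rw [not_disjoint_iff_nonempty_inter] at h3
    exact hno (comp_sat hP.cont.2.isPreconnected
      (fun p hp => ⟨hP.sub hp, disjoint_left.1 hdis hp⟩) h3)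
  have heq := (Dn_sub hab hcd hP hP' h).antisymm (Dn_sub hab hcd hP' hP h2)
  have := locconst (rect_convex a b c d) hP.cont.1.isClosed hP'.cont.1.isClosed hdis
    (O := Dn a b c d P)
    (fun S hS hpre hne => comp_sat hpre hS hne)
    (fun S hS hpre hne => by rw [heq] at hne ⊢; exact comp_sat hpre hS hne)
    ⟨(a, c), ⟨left_mem_Icc.2 hab, left_mem_Icc.2 hcd⟩, Dn_bot hab hcd hP (left_mem_Icc.2 hab)⟩
  exact Dn_top hab hcd hP a (this ⟨left_mem_Icc.2 hab, right_mem_Icc.2 hcd⟩)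

/-- dynamical distance to S -/
def uS (Sg : Set R2) (h : R2 ≃ₜ R2) (S : Set R2) (x : R2) : ℝ :=
  sInf {t | 0 ≤ t ∧ ∃ C ⊆ Sg, IsContinuum C ∧ x ∈ C ∧ (C ∩ S).Nonempty ∧ DiamLE (h '' C) t}

lemma uS_le {Sg : Set R2} {h : R2 ≃ₜ R2} {S : Set R2} {x : R2} {t : ℝ} {C : Set R2} (hCs : C ⊆ Sg)
    (hC : IsContinuum C) (hx : x ∈ C) (hS : (C ∩ S).Nonempty) (hd : DiamLE (h '' C) t) : uS Sg h S x ≤ t := by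
  have h0 : 0 ≤ t := by
    have := hd (h x) ⟨x, hx, rfl⟩ (h x) ⟨x, hx, rfl⟩
    simpa using this
  exact csInf_le ⟨0, fun s hs => hs.1⟩ ⟨h0, C, hCs, hC, hx, hS, hd⟩

lemma uS_nonneg {Sg : Set R2} {h : R2 ≃ₜ R2} {S : Set R2} {x : R2} : 0 ≤ uS Sg h S x :=
  Real.sInf_nonneg fun _ hs => hs.1

lemma seg_continuum (x y : R2) : IsContinuum (segment ℝ x y) := by
  refine ⟨?_, ⟨x, left_mem_segment ℝ x y⟩, (convex_segment x y).isPreconnected⟩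
  rw [segment_eq_image_lineMap]
  exact isCompact_Icc.image (by fun_prop)

lemma continuum_union {C C' : Set R2} (hC : IsContinuum C) (hC' : IsContinuum C') {x : R2} (h : x ∈ C) (h' : x ∈ C') :
    IsContinuum (C ∪ C') := ⟨hC.1.union hC'.1, hC.2.union ⟨x, h, h'⟩ hC'.2⟩

lemma diamLE_union {C C' : Set R2} {x : R2} {s t : ℝ} (h : x ∈ C) (h' : x ∈ C') (hs : DiamLE C s) (ht : DiamLE C' t) :
    DiamLE (C ∪ C') (s + t) := by
  have h0 : 0 ≤ s := by simpa using hs x h x h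
  have h0' : 0 ≤ t := by simpa using ht x h' x h'
  rintro y (hy | hy) z (hz | hz)
  · linarith [hs y hy z hz]
  · linarith [hs y hy x h, ht x h' z hz, dist_triangle y x z]
  · linarith [ht y hy x h', hs x h z hz, dist_triangle y x z]
  · linarith [ht y hy z hz]

lemma uS_lt {Sg : Set R2} (hSg : Convex ℝ Sg) (hSc : IsCompact Sg) {h : R2 ≃ₜ R2} {S : Set R2} (hS : (Sg ∩ S).Nonempty) {x : R2}
    (hx : x ∈ Sg) {t : ℝ} (ht : uS Sg h S x < t) : ∃ s < t, ∃ C ⊆ Sg, IsContinuum C ∧ x ∈ C ∧ (C ∩ S).Nonempty ∧ DiamLE (h '' C) s := by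
  obtain ⟨s, ⟨h0, hs⟩, hst⟩ := exists_lt_of_csInf_lt (by
    obtain ⟨y, hy, hyS⟩ := hS
    have hcomp : IsCompact (h '' Sg) := hSc.image h.continuous
    obtain ⟨t, ht⟩ := Metric.isBounded_iff.1 hcomp.isBounded
    refine ⟨max t 0, le_max_right _ _, segment ℝ x y, hSg.segment_subset hx hy, seg_continuum x y,
      left_mem_segment ℝ x y, ⟨y, right_mem_segment ℝ x y, hyS⟩, ?_⟩
    intro p hp q hq
    exact (ht (image_mono (hSg.segment_subset hx hy) hp) (image_mono (hSg.segment_subset hx hy) hq)).trans (le_max_left _ _)) ht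
  exact ⟨s, hst, hs⟩

lemma uS_cont {Sg : Set R2} (hSg : Convex ℝ Sg) (hSc : IsCompact Sg) {h : R2 ≃ₜ R2} {S : Set R2} (hS : (Sg ∩ S).Nonempty) :
    ContinuousOn (uS Sg h S) Sg := by
  have key : ∀ ε > 0, ∃ δ > 0, ∀ x ∈ Sg, ∀ y ∈ Sg, dist x y < δ → uS Sg h S y ≤ uS Sg h S x + ε := by
    intro ε hε
    have huc := hSc.uniformContinuousOn_of_continuous h.continuous.continuousOn
    rw [Metric.uniformContinuousOn_iff] at huc
    obtain ⟨δ, hδ, hu⟩ := huc (ε / 2) (by linarith)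
    refine ⟨δ, hδ, fun x hx y hy hxy => ?_⟩
    have hseg := hSg.segment_subset hx hy
    have hxs : ∀ p ∈ segment ℝ x y, dist p x < δ := by
      have : segment ℝ x y ⊆ ball x δ := (convex_ball x δ).segment_subset (mem_ball_self hδ) (by rwa [mem_ball, dist_comm])
      intro p hp
      exact this hp
    have hsd : DiamLE (h '' segment ℝ x y) ε := by
      rintro _ ⟨p, hp, rfl⟩ _ ⟨q, hq, rfl⟩
      have h1 := hu p (hseg hp) x hx (hxs p hp)
      have h2 := hu q (hseg hq) x hx (hxs q hq)
      linarith [dist_triangle_right (h p) (h q) (h x)]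
    refine le_of_forall_pos_le_add fun η hη => ?_
    obtain ⟨s, hs, C, hCs, hC, hxC, hCS, hd⟩ := uS_lt hSg hSc hS hx (lt_add_of_pos_right (uS Sg h S x) hη)
    have := uS_le (union_subset hCs hseg) (continuum_union hC (seg_continuum x y) hxC (left_mem_segment ℝ x y))
      (x := y) (Or.inr (right_mem_segment ℝ x y)) (hCS.mono (inter_subset_inter_left _ subset_union_left)) (h := h) (t := s + ε) (by
        rw [image_union]
        exact diamLE_union ⟨x, hxC, rfl⟩ ⟨x, left_mem_segment ℝ x y, rfl⟩ hd hsd)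
    linarith
  rw [Metric.continuousOn_iff]
  intro x hx ε hε
  obtain ⟨δ, hδ, hk⟩ := key (ε / 2) (by linarith)
  refine ⟨δ, hδ, fun y hy hyx => ?_⟩
  have h1 := hk x hx y hy (by rwa [dist_comm])
  have h2 := hk y hy x hx hyx
  rw [Real.dist_eq, abs_lt]
  constructor <;> linarith


/-- first exit from a rectangle along a continuous curve -/
lemma first_exit {a b c d : ℝ} (ψ : ℝ → R2) (hψ : Continuous ψ) (h0 : ψ 0 ∈ Rect a b c d)
    (h1 : ψ 1 ∉ Rect a b c d) : ∃ t ∈ Icc (0:ℝ) 1, (∀ s ∈ Icc 0 t, ψ s ∈ Rect a b c d) ∧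
      ((ψ t).1 = a ∨ (ψ t).1 = b ∨ (ψ t).2 = c ∨ (ψ t).2 = d) := by
  let φ : R2 → ℝ := fun p => min (min (p.1 - a) (b - p.1)) (min (p.2 - c) (d - p.2))
  have hφ : Continuous φ := by fun_prop
  have hmem : ∀ p, 0 ≤ φ p ↔ p ∈ Rect a b c d := by
    intro p
    simp only [φ, le_min_iff, sub_nonneg, Rect, mem_prod, mem_Icc]
  have hc : Continuous fun t => φ (ψ t) := hφ.comp hψ
  have h1' : φ (ψ 1) < 0 := by rw [← not_le, hmem]; exact h1
  have hcomp : IsCompact (Icc (0:ℝ) 1 ∩ {t | φ (ψ t) ≤ 0}) :=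
    isCompact_Icc.inter_right (isClosed_le hc continuous_const)
  obtain ⟨t, ⟨ht, ht0⟩, hleast⟩ := hcomp.exists_isLeast ⟨1, right_mem_Icc.2 zero_le_one, h1'.le⟩
  have hpos : ∀ s ∈ Icc (0:ℝ) 1, s < t → 0 < φ (ψ s) := by
    intro s hs hst
    by_contra hle
    exact absurd (hleast ⟨hs, not_lt.1 hle⟩) (not_le.2 hst)
  have hzero : φ (ψ t) = 0 := by
    refine le_antisymm ht0 ?_
    by_contra hlt
    rw [not_le] at hlt
    obtain ⟨s, hs, hs0⟩ := intermediate_value_Icc' ht.1 hc.continuousOn ⟨hlt.le, (hmem _).2 h0⟩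
    rcases hs.2.lt_or_eq with h | h
    · have := hpos s ⟨hs.1, hs.2.trans ht.2⟩ h
      simp only at hs0
      linarith
    · subst h
      simp only at hs0
      linarith
  refine ⟨t, ht, fun s hs => ?_, ?_⟩
  · rw [← hmem]
    rcases hs.2.lt_or_eq with h | h
    · exact (hpos s ⟨hs.1, hs.2.trans ht.2⟩ h).le
    · rw [h, hzero]
  · have := hzero
    simp only [φ] at this
    rcases min_choice (min ((ψ t).1 - a) (b - (ψ t).1)) (min ((ψ t).2 - c) (d - (ψ t).2)) with h | h
    · rw [h] at this
      rcases min_choice ((ψ t).1 - a) (b - (ψ t).1) with h' | h'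
      · left; rw [h'] at this; linarith
      · right; left; rw [h'] at this; linarith
    · rw [h] at this
      rcases min_choice ((ψ t).2 - c) (d - (ψ t).2) with h' | h'
      · right; right; left; rw [h'] at this; linarith
      · right; right; right; rw [h'] at this; linarith

lemma planar_aux {a b c d : ℝ} (hab : a < b) (hcd : c < d) {P P' : Set R2} (hP : Cross a b c d P)
    (hP' : Cross a b c d P') (hdis : Disjoint P P') (hord : Disjoint P' (Dn a b c d P))
    (h : R2 ≃ₜ R2) (hfar : ∀ p ∈ P, ∀ p' ∈ P', 2 < dist (h p) (h p'))
    (Γ : Set R2) (hΓ : Γ ⊆ Rect a b c d) {ε : ℝ} (hε : 0 < ε)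
    (hnet : ∀ y ∈ Rect a b c d, ∃ q ∈ Γ, dist q y ≤ ε)
    (hpat : ∀ q ∈ Γ, q ∈ Dn a b c d P ↔ q ∈ Dn a b c d P') {r : ℝ} (hr : 0 < r) (hr4 : r ≤ 1 / 4) :
    ∃ C : Set R2, IsContinuum C ∧ (∀ y ∈ C, ∃ p ∈ P ∪ P', dist y p ≤ ε) ∧
      DiamLE (h '' C) (2 * r) ∧ (DiamGE C (b - a) ∨ ∃ q, h '' C = closedBall q (r / 4)) := by
  set Sg := Rect a b c d with hSgdef
  have hSg : Convex ℝ Sg := rect_convex a b c d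
  have hSc : IsCompact Sg := rect_compact a b c d
  set D := Dn a b c d P with hD
  set D' := Dn a b c d P' with hD'
  have hDD' : D ⊆ D' := Dn_sub hab.le hcd.le hP hP' hord
  have hPD' : P ⊆ D' := Dn_sub2 hab.le hcd.le hP hP' hdis hord
  let Bt : Set R2 := D ∪ P
  let Tp : Set R2 := Sg \ D'
  have hcross : ∀ C ⊆ Sg, IsPreconnected C → (C ∩ Bt).Nonempty → (C ∩ Tp).Nonempty →
      (C ∩ P).Nonempty ∧ (C ∩ P').Nonempty := by
    intro C hC hpre hB hT
    obtain ⟨t, htC, htT⟩ := hT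
    obtain ⟨s, hsC, hsB⟩ := hB
    constructor
    · by_contra hno
      have hCP : C ⊆ Sg \ P := fun y hy => ⟨hC hy, fun hyP => hno ⟨y, hy, hyP⟩⟩
      rcases hsB with hs | hs
      · exact htT.2 (hDD' (comp_sat hpre hCP ⟨s, hsC, hs⟩ htC))
      · exact hno ⟨s, hsC, hs⟩
    · by_contra hno
      have hCP : C ⊆ Sg \ P' := fun y hy => ⟨hC hy, fun hyP => hno ⟨y, hy, hyP⟩⟩
      have hs' : s ∈ D' := by
        rcases hsB with hs | hs
        · exact hDD' hs
        · exact hPD' hs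
      exact htT.2 (comp_sat hpre hCP ⟨s, hsC, hs'⟩ htC)
  have hbotB : ∀ x ∈ Icc a b, (x, c) ∈ Bt := fun x hx => Or.inl (Dn_bot hab.le hcd.le hP hx)
  have htopT : ∀ x ∈ Icc a b, (x, d) ∈ Tp := fun x hx =>
    ⟨⟨hx, right_mem_Icc.2 hcd.le⟩, Dn_top hab.le hcd.le hP' x⟩
  let Lf : Set R2 := {p | p.1 = a}
  let Rt : Set R2 := {p | p.1 = b}
  have hLne : (Sg ∩ Lf).Nonempty := ⟨(a, c), ⟨left_mem_Icc.2 hab.le, left_mem_Icc.2 hcd.le⟩, rfl⟩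
  have hRne : (Sg ∩ Rt).Nonempty := ⟨(b, c), ⟨right_mem_Icc.2 hab.le, left_mem_Icc.2 hcd.le⟩, rfl⟩
  have hBne : (Sg ∩ Bt).Nonempty := ⟨(a, c), ⟨left_mem_Icc.2 hab.le, left_mem_Icc.2 hcd.le⟩,
    hbotB a (left_mem_Icc.2 hab.le)⟩
  have hTne : (Sg ∩ Tp).Nonempty := ⟨(a, d), ⟨left_mem_Icc.2 hab.le, right_mem_Icc.2 hcd.le⟩,
    htopT a (left_mem_Icc.2 hab.le)⟩
  have hzero : ∀ S : Set R2, ∀ x ∈ Sg, x ∈ S → uS Sg h S x ≤ 0 := by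
    intro S x hx hxS
    refine uS_le (C := {x}) (by simpa using hx) ⟨isCompact_singleton, isConnected_singleton⟩ rfl ⟨x, rfl, hxS⟩ ?_
    rintro _ ⟨p, hp, rfl⟩ _ ⟨q, hq, rfl⟩
    rw [mem_singleton_iff] at hp hq
    rw [hp, hq, dist_self]
  obtain ⟨x, hx, hf, hg⟩ := pm_rect (fun x => uS Sg h Lf x - uS Sg h Rt x)
    (fun x => uS Sg h Bt x - uS Sg h Tp x) a b c d hab.le hcd.le
    ((uS_cont hSg hSc hLne).sub (uS_cont hSg hSc hRne))
    ((uS_cont hSg hSc hBne).sub (uS_cont hSg hSc hTne))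
    (fun t ht => by
      have := hzero Lf (a, t) ⟨left_mem_Icc.2 hab.le, ht⟩ rfl
      have : 0 ≤ uS Sg h Rt (a, t) := uS_nonneg
      linarith)
    (fun t ht => by
      have := hzero Rt (b, t) ⟨right_mem_Icc.2 hab.le, ht⟩ rfl
      have : 0 ≤ uS Sg h Lf (b, t) := uS_nonneg
      linarith)
    (fun t ht => by
      have := hzero Bt (t, c) ⟨ht, left_mem_Icc.2 hcd.le⟩ (hbotB t ht)
      have : 0 ≤ uS Sg h Tp (t, c) := uS_nonneg
      linarith)
    (fun t ht => by
      have := hzero Tp (t, d) ⟨ht, right_mem_Icc.2 hcd.le⟩ (htopT t ht)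
      have : 0 ≤ uS Sg h Bt (t, d) := uS_nonneg
      linarith)
  have hBT : uS Sg h Bt x = uS Sg h Tp x := sub_eq_zero.1 hg
  have hLR : uS Sg h Lf x = uS Sg h Rt x := sub_eq_zero.1 hf
  have hB1 : 1 ≤ uS Sg h Bt x := by
    by_contra hlt
    rw [not_le] at hlt
    obtain ⟨s, hs, C, hCs, hC, hxC, hCS, hd⟩ := uS_lt hSg hSc hBne hx hlt
    rw [hBT] at hlt
    obtain ⟨s', hs', C', hCs', hC', hxC', hCS', hd'⟩ := uS_lt hSg hSc hTne hx hlt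
    obtain ⟨⟨p, hp, hpP⟩, ⟨p', hp', hpP'⟩⟩ := hcross (C ∪ C') (union_subset hCs hCs')
      (continuum_union hC hC' hxC hxC').2.isPreconnected
      (hCS.mono (inter_subset_inter_left _ subset_union_left))
      (hCS'.mono (inter_subset_inter_left _ subset_union_right))
    have h1 := hfar p hpP p' hpP'
    have hu : DiamLE (h '' (C ∪ C')) (s + s') := by
      rw [image_union]; exact diamLE_union ⟨x, hxC, rfl⟩ ⟨x, hxC', rfl⟩ hd hd'
    have := hu (h p) ⟨p, hp, rfl⟩ (h p') ⟨p', hp', rfl⟩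
    linarith
  -- finishing
  have finish : ∀ C ⊆ Sg, IsContinuum C → x ∈ C → DiamLE (h '' C) (2 * r) →
      ∀ y ∈ C, ∃ p ∈ P ∪ P', dist y p ≤ ε := by
    intro C hCs hC hxC hd y hy
    by_contra! hno
    have hyB : y ∉ Bt := fun hyB => by
      have := uS_le hCs hC hxC ⟨y, hy, hyB⟩ hd
      linarith
    have hyT : y ∉ Tp := fun hyT => by
      have := uS_le hCs hC hxC ⟨y, hy, hyT⟩ hd
      linarith
    have hySg := hCs hy
    have hyD' : y ∈ D' := by by_contra hn; exact hyT ⟨hySg, hn⟩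
    have hyD : y ∉ D := fun hn => hyB (Or.inl hn)
    obtain ⟨q, hq, hqy⟩ := hnet y hySg
    have hpre : IsPreconnected (Sg ∩ closedBall y ε) := (hSg.inter (convex_closedBall y ε)).isPreconnected
    have hyb : y ∈ Sg ∩ closedBall y ε := ⟨hySg, mem_closedBall_self hε.le⟩
    have hqb : q ∈ Sg ∩ closedBall y ε := ⟨hΓ hq, hqy⟩
    have hqD' : q ∈ D' := comp_sat (F := Sg \ P') (x := (a, c)) hpre (fun w hw => ⟨hw.1, fun hwP => by
      have := hno w (Or.inr hwP)
      have h2 := hw.2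
      rw [mem_closedBall, dist_comm] at h2
      linarith⟩) ⟨y, hyb, hyD'⟩ hqb
    have hqD : q ∈ D := (hpat q hq).2 hqD'
    have : y ∈ D := comp_sat (F := Sg \ P) (x := (a, c)) hpre (fun w hw => ⟨hw.1, fun hwP => by
      have := hno w (Or.inl hwP)
      have h2 := hw.2
      rw [mem_closedBall, dist_comm] at h2
      linarith⟩) ⟨q, hqb, hqD⟩ hyb
    exact hyD this
  rcases lt_or_ge (uS Sg h Lf x) r with hlt | hge
  · obtain ⟨s, hs, C, hCs, hC, hxC, ⟨l, hlC, hl⟩, hd⟩ := uS_lt hSg hSc hLne hx hlt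
    rw [hLR] at hlt
    obtain ⟨s', hs', C', hCs', hC', hxC', ⟨l', hlC', hl'⟩, hd'⟩ := uS_lt hSg hSc hRne hx hlt
    have hu : DiamLE (h '' (C ∪ C')) (2 * r) := by
      rw [image_union]
      exact (diamLE_union (C := h '' C) (C' := h '' C') (x := h x) ⟨x, hxC, rfl⟩ ⟨x, hxC', rfl⟩ hd hd').mono subset_rfl (by linarith)
    have hcu := continuum_union hC hC' hxC hxC'
    refine ⟨C ∪ C', hcu, finish _ (union_subset hCs hCs') hcu (Or.inl hxC) hu, hu, Or.inl ?_⟩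
    refine ⟨l', Or.inr hlC', l, Or.inl hlC, ?_⟩
    have e1 : l.1 = a := hl
    have e2 : l'.1 = b := hl'
    calc b - a ≤ |l'.1 - l.1| := by rw [e1, e2]; exact le_abs_self _
      _ = dist l'.1 l.1 := (Real.dist_eq _ _).symm
      _ ≤ dist l' l := by rw [Prod.dist_eq]; exact le_max_left _ _
  · have hsub : h.symm '' closedBall (h x) (r / 4) ⊆ Sg := by
      rintro _ ⟨q, hq, rfl⟩
      by_contra hqS
      let ψ : ℝ → R2 := fun t => h.symm (AffineMap.lineMap (h x) q t)
      have hψ : Continuous ψ := h.symm.continuous.comp (by fun_prop)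
      obtain ⟨t, ht, hin, hside⟩ := first_exit (a := a) (b := b) (c := c) (d := d) ψ hψ
        (by simpa [ψ] using hx) (by simpa [ψ] using hqS)
      have hcs : ψ '' Icc 0 t ⊆ Sg := by rintro _ ⟨s, hs, rfl⟩; exact hin s hs
      have hcc : IsContinuum (ψ '' Icc 0 t) :=
        IsContinuum.image ⟨isCompact_Icc, isConnected_Icc ht.1⟩ hψ
      have hxc : x ∈ ψ '' Icc 0 t := ⟨0, left_mem_Icc.2 ht.1, by simp [ψ]⟩
      have htc : ψ t ∈ ψ '' Icc 0 t := ⟨t, right_mem_Icc.2 ht.1, rfl⟩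
      have hdd : DiamLE (h '' (ψ '' Icc 0 t)) (r / 2) := by
        refine (diamLE_closedBall (x := h x) (r := r / 4)).mono ?_ (by linarith)
        rintro _ ⟨_, ⟨s, hs, rfl⟩, rfl⟩
        simp only [ψ, Homeomorph.apply_symm_apply]
        have h2 : segment ℝ (h x) q ⊆ closedBall (h x) (r / 4) :=
          (convex_closedBall _ _).segment_subset (mem_closedBall_self (by linarith)) hq
        apply h2
        rw [segment_eq_image_lineMap]
        exact ⟨s, ⟨hs.1, hs.2.trans ht.2⟩, rfl⟩
      have hu : ∀ S : Set R2, ψ t ∈ S → uS Sg h S x ≤ r / 2 := fun S hS =>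
        uS_le hcs hcc hxc ⟨ψ t, htc, hS⟩ hdd
      have hψt : ψ t ∈ Sg := hcs htc
      rcases hside with hs | hs | hs | hs
      · have := hu Lf hs; linarith
      · have := hu Rt hs; linarith
      · have := hu Bt (by
          have := hbotB (ψ t).1 hψt.1
          rw [← hs] at this; exact this)
        linarith
      · have := hu Tp (by
          have := htopT (ψ t).1 hψt.1
          rw [← hs] at this; exact this)
        linarith
    have him : h '' (h.symm '' closedBall (h x) (r / 4)) = closedBall (h x) (r / 4) := by
      rw [image_image]; simp
    have hcont : IsContinuum (h.symm '' closedBall (h x) (r / 4)) := by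
      refine IsContinuum.image ⟨isCompact_closedBall _ _, ⟨h x, mem_closedBall_self (by linarith)⟩,
        (convex_closedBall _ _).isPreconnected⟩ h.symm.continuous
    have hd : DiamLE (h '' (h.symm '' closedBall (h x) (r / 4))) (2 * r) := by
      rw [him]; exact diamLE_closedBall.mono subset_rfl (by linarith)
    exact ⟨_, hcont, finish _ hsub hcont ⟨h x, mem_closedBall_self (by linarith), by simp⟩ hd, hd,
      Or.inr ⟨_, him⟩⟩

lemma planar {a b c d : ℝ} (hab : a < b) (hcd : c < d) {P P' : Set R2} (hP : Cross a b c d P)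
    (hP' : Cross a b c d P')
    (h : R2 ≃ₜ R2) (hfar : ∀ p ∈ P, ∀ p' ∈ P', 2 < dist (h p) (h p'))
    (Γ : Set R2) (hΓ : Γ ⊆ Rect a b c d) {ε : ℝ} (hε : 0 < ε)
    (hnet : ∀ y ∈ Rect a b c d, ∃ q ∈ Γ, dist q y ≤ ε)
    (hpat : ∀ q ∈ Γ, q ∈ Dn a b c d P ↔ q ∈ Dn a b c d P') {r : ℝ} (hr : 0 < r) (hr4 : r ≤ 1 / 4) :
    ∃ C : Set R2, IsContinuum C ∧ (∀ y ∈ C, ∃ p ∈ P ∪ P', dist y p ≤ ε) ∧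
      DiamLE (h '' C) (2 * r) ∧ (DiamGE C (b - a) ∨ ∃ q, h '' C = closedBall q (r / 4)) := by
  have hdis : Disjoint P P' := by
    rw [disjoint_left]
    intro p hp hp'
    have := hfar p hp p hp'
    simp only [dist_self] at this
    linarith
  rcases Dn_order hab.le hcd.le hP hP' hdis with ho | ho
  · exact planar_aux hab hcd hP hP' hdis ho h hfar Γ hΓ hε hnet hpat hr hr4
  · have := planar_aux hab hcd hP' hP hdis.symm ho h (fun p hp p' hp' => by
      rw [dist_comm]; exact hfar p' hp' p hp) Γ hΓ hε hnet (fun q hq => (hpat q hq).symm) hr hr4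
    rwa [union_comm] at this


/-! ### Basic dynamics -/

def tr (v : ℤ × ℤ) : R2 := ((v.1 : ℝ), (v.2 : ℝ))

def Comm (H : R2 ≃ₜ R2) : Prop := ∀ (x : R2) (v : ℤ × ℤ), H (x + tr v) = H x + tr v

lemma iterZ_eq (G : R2 ≃ₜ R2) (j : ℤ) : iterZ G j = ⇑(G ^ j) := by
  have key : ∀ (H : R2 ≃ₜ R2) (n : ℕ), ⇑(H ^ n) = (⇑H)^[n] := by
    intro H n
    induction n with
    | zero => rfl
    | succ n ih =>
      ext1 x
      rw [pow_succ, Homeomorph.mul_apply, ih, Function.iterate_succ_apply]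
  cases j with
  | ofNat n => exact (key G n).symm
  | negSucc n =>
    rw [zpow_negSucc, ← inv_pow]
    exact (key G⁻¹ (n + 1)).symm

lemma nat_iter_eq (G : R2 ≃ₜ R2) (n : ℕ) : (⇑G)^[n] = ⇑(G ^ (n : ℤ)) := iterZ_eq G n

lemma zadd (G : R2 ≃ₜ R2) (i j : ℤ) (x : R2) : (G ^ (i + j)) x = (G ^ i) ((G ^ j) x) := by
  rw [zpow_add]; rfl

lemma zadd_image (G : R2 ≃ₜ R2) (i j : ℤ) (S : Set R2) : (G ^ (i + j)) '' S = (G ^ i) '' ((G ^ j) '' S) := by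
  rw [image_image]; exact image_congr fun x _ => zadd G i j x

lemma z0_image (G : R2 ≃ₜ R2) (S : Set R2) : (G ^ (0:ℤ)) '' S = S := by
  rw [zpow_zero]
  exact image_id S

lemma comm_mul {H K : R2 ≃ₜ R2} (h : Comm H) (k : Comm K) : Comm (H * K) := by
  intro x v
  simp only [Homeomorph.mul_apply, k x v, h _ v]

lemma comm_inv {H : R2 ≃ₜ R2} (h : Comm H) : Comm H⁻¹ := by
  intro x v
  apply H.injective
  rw [h]
  simp

lemma comm_zpow {G : R2 ≃ₜ R2} (h : Comm G) (i : ℤ) : Comm (G ^ i) := by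
  have hn : ∀ n : ℕ, Comm (G ^ n) := by
    intro n
    induction n with
    | zero => intro x v; rfl
    | succ n ih => rw [pow_succ]; exact comm_mul ih h
  cases i with
  | ofNat n => exact hn n
  | negSucc n => rw [zpow_negSucc]; exact comm_inv (hn _)

def flr (x : R2) : ℤ × ℤ := (⌊x.1⌋, ⌊x.2⌋)

lemma flr_mem (x : R2) : x - tr (flr x) ∈ Rect 0 1 0 1 := by
  simp only [tr, flr, Rect, mem_prod, mem_Icc, Prod.fst_sub, Prod.snd_sub]
  have h1 := Int.floor_le x.1
  have h2 := Int.lt_floor_add_one x.1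
  have h3 := Int.floor_le x.2
  have h4 := Int.lt_floor_add_one x.2
  refine ⟨⟨?_, ?_⟩, ?_, ?_⟩ <;> linarith

lemma tr_add (v w : ℤ × ℤ) : tr (v + w) = tr v + tr w := by
  simp [tr]

lemma comm_sub {H : R2 ≃ₜ R2} (h : Comm H) (x : R2) (v : ℤ × ℤ) : H (x - tr v) = H x - tr v := by
  have := h (x - tr v) v
  rw [sub_add_cancel] at this
  rw [this]; simp

lemma comm_disp {H : R2 ≃ₜ R2} (h : Comm H) : ∃ C, 0 ≤ C ∧ ∀ x, dist (H x) x ≤ C := by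
  obtain ⟨C, hC⟩ := (rect_compact 0 1 0 1).bddAbove_image
    (f := fun x => dist (H x) x) (by have := H.continuous; fun_prop)
  refine ⟨max C 0, le_max_right _ _, fun x => ?_⟩
  have := hC ⟨_, flr_mem x, rfl⟩
  simp only [comm_sub h, dist_sub_right] at this
  exact this.trans (le_max_left _ _)

lemma comm_unif {H : R2 ≃ₜ R2} (h : Comm H) {ε : ℝ} (hε : 0 < ε) :
    ∃ δ > 0, ∀ x y, dist x y ≤ δ → dist (H x) (H y) ≤ ε := by
  have huc := (rect_compact (-1) 2 (-1) 2).uniformContinuousOn_of_continuous H.continuous.continuousOn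
  rw [Metric.uniformContinuousOn_iff] at huc
  obtain ⟨δ, hδ, hu⟩ := huc ε hε
  refine ⟨min (δ / 2) 1, by positivity, fun x y hxy => ?_⟩
  have h1 : dist x y ≤ δ / 2 := hxy.trans (min_le_left _ _)
  have h2 : dist x y ≤ 1 := hxy.trans (min_le_right _ _)
  have hx := flr_mem x
  have hd : dist (x - tr (flr x)) (y - tr (flr x)) = dist x y := dist_sub_right _ _ _
  have := hu (x - tr (flr x)) (by
    simp only [Rect, mem_prod, mem_Icc] at hx ⊢
    refine ⟨⟨?_, ?_⟩, ?_, ?_⟩ <;> linarith [hx.1.1, hx.1.2, hx.2.1, hx.2.2]) (y - tr (flr x)) (by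
    rw [Prod.dist_eq] at hd
    have e1 := (le_max_left _ _).trans (hd.le.trans h2)
    have e2 := (le_max_right _ _).trans (hd.le.trans h2)
    rw [Real.dist_eq, abs_le] at e1 e2
    simp only [Rect, mem_prod, mem_Icc] at hx ⊢
    refine ⟨⟨?_, ?_⟩, ?_, ?_⟩ <;> linarith [hx.1.1, hx.1.2, hx.2.1, hx.2.2]) (by rw [hd]; linarith)
  rw [comm_sub h, comm_sub h, dist_sub_right] at this
  exact this.le

lemma unif_upto {G : R2 ≃ₜ R2} (h : Comm G) (N : ℕ) {ε : ℝ} (hε : 0 < ε) :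
    ∃ δ > 0, δ ≤ ε ∧ ∀ x y, dist x y ≤ δ → ∀ i : ℤ, 0 ≤ i → i ≤ N → dist ((G ^ i) x) ((G ^ i) y) ≤ ε := by
  induction N with
  | zero =>
    refine ⟨ε, hε, le_rfl, fun x y hxy i h0 h1 => ?_⟩
    have : i = 0 := by push_cast at h1; omega
    subst this
    simpa using hxy
  | succ N ih =>
    obtain ⟨δ, hδ, hδε, hi⟩ := ih
    obtain ⟨δ', hδ', hi'⟩ := comm_unif (comm_zpow h (N + 1)) hε
    refine ⟨min δ δ', by positivity, (min_le_left _ _).trans hδε, fun x y hxy i h0 h1 => ?_⟩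
    rcases h1.lt_or_eq with h2 | h2
    · exact hi x y (hxy.trans (min_le_left _ _)) i h0 (by push_cast at h2; omega)
    · rw [h2]; push_cast; exact hi' x y (hxy.trans (min_le_right _ _))

lemma disp_nat {G : R2 ≃ₜ R2} {C : ℝ} (hC : ∀ x, dist (G x) x ≤ C) (n : ℕ) (x : R2) :
    dist ((G ^ (n : ℤ)) x) x ≤ C * n := by
  induction n with
  | zero => simp
  | succ n ih =>
    have h1 : (G ^ ((n + 1 : ℕ) : ℤ)) x = G ((G ^ (n : ℤ)) x) := by
      push_cast
      rw [add_comm, zadd]; simp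
    rw [h1]
    have := dist_triangle (G ((G ^ (n : ℤ)) x)) ((G ^ (n : ℤ)) x) x
    have := hC ((G ^ (n : ℤ)) x)
    push_cast
    linarith

/-- translation of a set by an integer vector -/
def trS (v : ℤ × ℤ) (S : Set R2) : Set R2 := (fun x => x + tr v) '' S

lemma trS_image {H : R2 ≃ₜ R2} (h : Comm H) (v : ℤ × ℤ) (S : Set R2) : H '' (trS v S) = trS v (H '' S) := by
  simp only [trS, image_image, h _ v]

lemma trS_diamLE {v : ℤ × ℤ} {S : Set R2} {c : ℝ} (h : DiamLE S c) : DiamLE (trS v S) c := by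
  rintro _ ⟨x, hx, rfl⟩ _ ⟨y, hy, rfl⟩
  rw [dist_add_right]; exact h x hx y hy

lemma trS_diamGE {v : ℤ × ℤ} {S : Set R2} {c : ℝ} (h : DiamGE S c) : DiamGE (trS v S) c := by
  obtain ⟨x, hx, y, hy, h⟩ := h
  exact ⟨_, ⟨x, hx, rfl⟩, _, ⟨y, hy, rfl⟩, by rwa [dist_add_right]⟩

lemma trS_cont {v : ℤ × ℤ} {S : Set R2} (h : IsContinuum S) : IsContinuum (trS v S) :=
  h.image (by fun_prop)

lemma dist_zero_of_rect {x : R2} (hx : x ∈ Rect 0 1 0 1) : dist x 0 ≤ 1 := by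
  simp only [Rect, mem_prod, mem_Icc] at hx
  rw [Prod.dist_eq]
  apply max_le <;> rw [Real.dist_eq, abs_le] <;> constructor <;> simp <;> linarith [hx.1.1, hx.1.2, hx.2.1, hx.2.2]

/-- nontrivial continua are not dynamically bounded -/
def Expd (G : R2 ≃ₜ R2) : Prop := ∀ K : Set R2, IsContinuum K → ∀ Δ : ℝ,
  (∀ i : ℤ, DiamLE ((G ^ i) '' K) Δ) → ∀ x ∈ K, ∀ y ∈ K, x = y

lemma expd_of (G : R2 ≃ₜ R2) (hexp : ∀ K : Set R2, IsContinuum K → K.Nontrivial → dynDiam G K = ⊤) :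
    Expd G := by
  intro K hK Δ hd x hx y hy
  by_contra hne
  have := hexp K hK ⟨x, hx, y, hy, hne⟩
  have h2 : dynDiam G K ≤ ENNReal.ofReal Δ := by
    refine iSup_le fun j => ?_
    rw [iterZ_eq]
    refine Metric.ediam_le fun p hp q hq => ?_
    rw [edist_dist]
    exact ENNReal.ofReal_le_ofReal (hd j p hp q hq)
  rw [this] at h2
  exact ENNReal.ofReal_ne_top (top_le_iff.1 h2)

/-- uniform expansivity -/
lemma unif_exp {G : R2 ≃ₜ R2} (hc : Comm G) (he : Expd G) {δ : ℝ} (hδ : 0 < δ) (Δ : ℝ) :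
    ∃ N : ℕ, ∀ A : Set R2, IsContinuum A → DiamGE A δ →
      ∃ i : ℤ, |i| ≤ (N : ℤ) ∧ ¬ DiamLE ((G ^ i) '' A) Δ := by
  by_contra! hno
  choose A0 hA0 hA0d hA0i using hno
  choose p hp using fun n => (hA0 n).2.nonempty
  let B : ℕ → Set R2 := fun n => trS (- flr (p n)) (A0 n)
  have hB : ∀ n, IsContinuum (B n) := fun n => trS_cont (hA0 n)
  have hBd : ∀ n, DiamGE (B n) δ := fun n => trS_diamGE (hA0d n)
  have hBi : ∀ (n : ℕ) (i : ℤ), |i| ≤ (n : ℤ) → DiamLE ((G ^ i) '' B n) Δ := fun n i hi => by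
    simp only [B]
    rw [trS_image (comm_zpow hc i)]; exact trS_diamLE (hA0i n i hi)
  have hB0 : ∀ n, B n ⊆ closedBall 0 (1 + Δ) := by
    intro n x hx
    have h1 : p n - tr (flr (p n)) ∈ B n := ⟨p n, hp n, by simp [tr, sub_eq_add_neg]⟩
    have h2 := hBi n 0 (by simp)
    rw [z0_image] at h2
    have h3 := h2 x hx _ h1
    have h4 := dist_zero_of_rect (flr_mem (p n))
    rw [mem_closedBall]
    linarith [dist_triangle x (p n - tr (flr (p n))) 0]
  let U : Ultrafilter ℕ := hyperfilter ℕ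
  have hUat : (U : Filter ℕ) ≤ atTop := Nat.hyperfilter_le_atTop
  let A : Set R2 := {x | ∀ ε > 0, ∀ᶠ n in (U : Filter ℕ), ∃ y ∈ B n, dist y x < ε}
  have hlim : ∀ a : ℕ → R2, (∀ n, a n ∈ B n) → ∃ x ∈ A, Tendsto a U (𝓝 x) := by
    intro a ha
    obtain ⟨x, -, hx⟩ := (isCompact_closedBall (0 : R2) (1 + Δ)).ultrafilter_le_nhds (U.map a) (by
      rw [le_principal_iff]
      have : ∀ᶠ n in (U : Filter ℕ), a n ∈ closedBall (0 : R2) (1 + Δ) :=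
        Filter.Eventually.of_forall (fun n => hB0 n (ha n))
      exact this)
    refine ⟨x, fun ε hε => ?_, hx⟩
    have h1 : ∀ᶠ n in (U : Filter ℕ), a n ∈ ball x ε := hx (ball_mem_nhds x hε)
    filter_upwards [h1] with n hn
    exact ⟨a n, ha n, hn⟩
  have hsub : ∀ V : Set R2, IsOpen V → A ⊆ V → ∀ᶠ n in (U : Filter ℕ), B n ⊆ V := by
    intro V hV hAV
    by_contra hn
    rw [← Ultrafilter.eventually_not] at hn
    have : ∀ n, ∃ x ∈ B n, (¬ B n ⊆ V) → x ∉ V := by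
      intro n
      by_cases h : B n ⊆ V
      · obtain ⟨x, hx⟩ := (hB n).2.nonempty
        exact ⟨x, hx, fun h' => absurd h h'⟩
      · obtain ⟨x, hx, hxV⟩ := not_subset.1 h
        exact ⟨x, hx, fun _ => hxV⟩
    choose a ha haV using this
    obtain ⟨x, hxA, hx⟩ := hlim a ha
    have h1 : ∀ᶠ n in (U : Filter ℕ), a n ∈ V := hx (hV.mem_nhds (hAV hxA))
    obtain ⟨n, h2, h3⟩ := (h1.and hn).exists
    exact haV n h3 h2
  have hAclosed : IsClosed A := by
    rw [← closure_subset_iff_isClosed]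
    intro x hx ε hε
    obtain ⟨y, hy, hxy⟩ := Metric.mem_closure_iff.1 hx (ε / 2) (by linarith)
    filter_upwards [hy (ε / 2) (by linarith)] with n hn
    obtain ⟨w, hw, hwy⟩ := hn
    refine ⟨w, hw, ?_⟩
    rw [dist_comm] at hxy
    linarith [dist_triangle w y x]
  have hAb : A ⊆ closedBall 0 (2 + Δ) := by
    intro x hx
    obtain ⟨n, y, hy, hyx⟩ := (hx 1 one_pos).exists
    have := hB0 n hy
    rw [mem_closedBall] at this ⊢
    rw [dist_comm] at hyx
    linarith [dist_triangle x y 0]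
  have hAcomp : IsCompact A := (isCompact_closedBall _ _).of_isClosed_subset hAclosed hAb
  have hApre : IsPreconnected A := by
    intro u v hu hv huv hAu hAv
    by_contra hemp
    rw [not_nonempty_iff_eq_empty] at hemp
    have hcu : IsCompact (A \ v) := hAcomp.diff hv
    have hcv : IsCompact (A \ u) := hAcomp.diff hu
    have hd : Disjoint (A \ v) (A \ u) := by
      rw [disjoint_left]
      rintro x ⟨hx, hxv⟩ ⟨-, hxu⟩
      rcases huv hx with h | h
      · exact hxu h
      · exact hxv h
    obtain ⟨u', v', hu', hv', huu, hvv, hdd⟩ := SeparatedNhds.of_isCompact_isCompact hcu hcv hd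
    have hnot : ∀ x ∈ A, ¬ (x ∈ u ∧ x ∈ v) := by
      intro x hx hh
      have : x ∈ A ∩ (u ∩ v) := ⟨hx, hh⟩
      rw [hemp] at this
      exact this
    have h1 := hsub (u' ∪ v') (hu'.union hv') (by
      intro x hx
      rcases huv hx with h | h
      · exact Or.inl (huu ⟨hx, fun hv => hnot x hx ⟨h, hv⟩⟩)
      · exact Or.inr (hvv ⟨hx, fun hv => hnot x hx ⟨hv, h⟩⟩))
    have meet : ∀ w : Set R2, IsOpen w → (A ∩ w).Nonempty → ∀ᶠ n in (U : Filter ℕ), (B n ∩ w).Nonempty := by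
      rintro w hw ⟨x, hxA, hxw⟩
      obtain ⟨ε, hε, hb⟩ := Metric.isOpen_iff.1 hw x hxw
      filter_upwards [hxA ε hε] with n hn
      obtain ⟨y, hy, hyx⟩ := hn
      exact ⟨y, hy, hb hyx⟩
    obtain ⟨x, hxA, hxu⟩ := hAu
    obtain ⟨y, hyA, hyv⟩ := hAv
    have h2 := meet u' hu' ⟨x, hxA, huu ⟨hxA, fun hv => hnot x hxA ⟨hxu, hv⟩⟩⟩
    have h3 := meet v' hv' ⟨y, hyA, hvv ⟨hyA, fun hv => hnot y hyA ⟨hv, hyv⟩⟩⟩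
    obtain ⟨n, ⟨hn1, hn2⟩, hn3⟩ := ((h1.and h2).and h3).exists
    obtain ⟨w, -, hw1, hw2⟩ := (hB n).2.isPreconnected u' v' hu' hv' hn1 hn2 hn3
    exact disjoint_left.1 hdd hw1 hw2
  choose x hx y hy hxy using hBd
  obtain ⟨x', hx'A, hx'⟩ := hlim x hx
  obtain ⟨y', hy'A, hy'⟩ := hlim y hy
  have hge : δ ≤ dist x' y' := ge_of_tendsto (hx'.dist hy') (Filter.Eventually.of_forall hxy)
  have hAi : ∀ i : ℤ, DiamLE ((G ^ i) '' A) Δ := by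
    rintro i _ ⟨s, hs, rfl⟩ _ ⟨t, ht, rfl⟩
    by_contra hlt
    rw [not_le] at hlt
    have hcts : Continuous fun q : R2 × R2 => dist ((G ^ i) q.1) ((G ^ i) q.2) := by
      have := (G ^ i).continuous
      fun_prop
    have hop : IsOpen {q : R2 × R2 | Δ < dist ((G ^ i) q.1) ((G ^ i) q.2)} := isOpen_lt continuous_const hcts
    obtain ⟨ε, hε, hb⟩ := Metric.isOpen_iff.1 hop (s, t) hlt
    have hi : ∀ᶠ n : ℕ in (U : Filter ℕ), |i| ≤ (n : ℤ) := by
      apply hUat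
      filter_upwards [eventually_ge_atTop i.natAbs] with n hn
      rw [Int.abs_eq_natAbs]
      exact_mod_cast hn
    obtain ⟨n, ⟨⟨s', hs', hss⟩, ⟨t', ht', htt⟩⟩, hn⟩ := (((hs ε hε).and (ht ε hε)).and hi).exists
    have h1 : (s', t') ∈ ball (s, t) ε := by
      rw [mem_ball, Prod.dist_eq]; exact max_lt hss htt
    have h2 := hb h1
    have h3 := hBi n i hn _ ⟨s', hs', rfl⟩ _ ⟨t', ht', rfl⟩
    simp only [mem_ofPred_eq] at h2
    linarith
  have := he A ⟨hAcomp, ⟨x', hx'A⟩, hApre⟩ Δ hAi x' hx'A y' hy'A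
  rw [this, dist_self] at hge
  linarith


/-! ### Growing pieces -/

structure Setup (G : R2 ≃ₜ R2) (N : ℕ) (κ : ℝ) : Prop where
  hc : Comm G
  he : Expd G
  hN : ∀ A : Set R2, IsContinuum A → DiamGE A 1 → ∃ i : ℤ, |i| ≤ (N : ℤ) ∧ ¬ DiamLE ((G ^ i) '' A) 2
  hκ : 0 < κ
  hκ1 : κ ≤ 1 / 2
  hun : ∀ x y, dist x y ≤ κ → ∀ i : ℤ, 0 ≤ i → i ≤ N → dist ((G ^ i) x) ((G ^ i) y) ≤ 1 / 2

lemma exists_setup {G : R2 ≃ₜ R2} (hc : Comm G) (he : Expd G) : ∃ N κ, Setup G N κ := by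
  obtain ⟨N, hN⟩ := unif_exp hc he one_pos 2
  obtain ⟨κ, h1, h2, h3⟩ := unif_upto hc N (ε := 1 / 2) (by norm_num)
  exact ⟨N, κ, hc, he, hN, h1, h2, h3⟩

def Unst (G : R2 ≃ₜ R2) (s t : ℤ) (Q : Set R2) : Prop :=
  IsContinuum Q ∧ ∀ i : ℤ, s ≤ i → i ≤ t → DiamLE ((G ^ i) '' Q) 2

section
variable {G : R2 ≃ₜ R2} {N : ℕ} {κ : ℝ}

lemma diamLE_image_mono {i : ℤ} {Q Q' : Set R2} {c : ℝ} (h : DiamLE ((G ^ i) '' Q) c) (hs : Q' ⊆ Q) :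
    DiamLE ((G ^ i) '' Q') c := h.mono (image_mono hs) le_rfl

lemma Setup.small (S : Setup G N κ) {s i : ℤ} {Q : Set R2} (h : DiamLE ((G ^ s) '' Q) κ) (h1 : s ≤ i) (h2 : i ≤ s + N) :
    DiamLE ((G ^ i) '' Q) (1 / 2) := by
  have : i = (i - s) + s := by ring
  rw [this, zadd_image]
  rintro _ ⟨x, hx, rfl⟩ _ ⟨y, hy, rfl⟩
  exact S.hun x y (h x hx y hy) (i - s) (by omega) (by omega)

lemma Setup.back (S : Setup G N κ) {s t : ℤ} {Q : Set R2} (h : DiamGE ((G ^ t) '' Q) 1) (h1 : s ≤ t) (h2 : t ≤ s + N) :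
    DiamGE ((G ^ s) '' Q) κ := by
  by_contra hno
  have hle : DiamLE ((G ^ s) '' Q) κ := by
    intro x hx y hy
    by_contra hlt
    exact hno ⟨x, hx, y, hy, (not_le.1 hlt).le⟩
  obtain ⟨x, hx, y, hy, hxy⟩ := h
  have := S.small hle h1 h2 x hx y hy
  linarith

lemma first_exceed {Q : Set R2} (hQ : IsContinuum Q) {s k : ℤ} (hs : DiamLE ((G ^ s) '' Q) 2) (hsk : s ≤ k)
    (hk : ¬ DiamLE ((G ^ k) '' Q) 2) {x : R2} (hx : x ∈ Q) :
    ∃ t, s < t ∧ t ≤ k ∧ ∃ Q' ⊆ Q, x ∈ Q' ∧ Unst G s t Q' ∧ DiamGE ((G ^ t) '' Q') 1 := by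
  classical
  have hex : ∃ n : ℕ, ¬ DiamLE ((G ^ (s + n)) '' Q) 2 := ⟨(k - s).toNat, by
    rw [Int.toNat_of_nonneg (by omega)]; simpa using hk⟩
  let n := Nat.find hex
  have hn : ¬ DiamLE ((G ^ (s + n)) '' Q) 2 := Nat.find_spec hex
  have hmin : ∀ m : ℕ, m < n → DiamLE ((G ^ (s + m)) '' Q) 2 := fun m hm => not_not.1 (Nat.find_min hex hm)
  have hn0 : n ≠ 0 := by
    intro h
    rw [h] at hn
    simp at hn
    exact hn hs
  have hnk : s + n ≤ k := by
    by_contra hlt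
    have := hmin (k - s).toNat (by omega)
    rw [Int.toNat_of_nonneg (by omega)] at this
    apply hk
    simpa using this
  obtain ⟨C, hCs, hC, hxC, hCb, hCd⟩ := cut_piece (hQ.image (G ^ (s + (n:ℤ))).continuous) ⟨x, hx, rfl⟩ one_pos
    (by simpa using not_diamLE_GE hn)
  have him : (G ^ (s + (n:ℤ))) '' ((G ^ (s + (n:ℤ))).symm '' C) = C := by rw [image_image]; simp
  have hsub : (G ^ (s + (n:ℤ))).symm '' C ⊆ Q := by
    rintro _ ⟨c, hc, rfl⟩
    obtain ⟨q, hq, rfl⟩ := hCs hc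
    simpa using hq
  refine ⟨s + n, by omega, hnk, _, hsub, ⟨_, hxC, by simp⟩, ⟨hC.image (Homeomorph.continuous _), ?_⟩, by rwa [him]⟩
  intro i hi1 hi2
  rcases hi2.lt_or_eq with h | h
  · have := hmin (i - s).toNat (by omega)
    rw [Int.toNat_of_nonneg (by omega)] at this
    have e : s + (i - s) = i := by ring
    rw [e] at this
    exact diamLE_image_mono this hsub
  · rw [h, him]
    exact diamLE_closedBall.mono hCb (by norm_num)

lemma Unst.mono {s t : ℤ} {Q Q' : Set R2} (h : Unst G s t Q) (hQ' : IsContinuum Q') (hs : Q' ⊆ Q) : Unst G s t Q' :=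
  ⟨hQ', fun i h1 h2 => diamLE_image_mono (h.2 i h1 h2) hs⟩

lemma Setup.grow (S : Setup G N κ) {s t : ℤ} {Q : Set R2} (hQ : Unst G s t Q) (hd : DiamGE ((G ^ t) '' Q) 1)
    (hst : s + N ≤ t) {x : R2} (hx : x ∈ Q) :
    ∃ t', t < t' ∧ t' ≤ t + N ∧ ∃ Q' ⊆ Q, x ∈ Q' ∧ Unst G s t' Q' ∧ DiamGE ((G ^ t') '' Q') 1 := by
  obtain ⟨i, hi, hi2⟩ := S.hN _ (hQ.1.image (G ^ t).continuous) hd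
  rw [← zadd_image] at hi2
  rw [abs_le] at hi
  have hpos : 0 < i := by
    by_contra h
    exact hi2 (hQ.2 _ (by omega) (by omega))
  obtain ⟨t', h1, h2, Q', hQs, hxQ, hU, hD⟩ := first_exceed hQ.1 (hQ.2 t (by omega) le_rfl) (by omega) hi2 hx
  refine ⟨t', h1, by omega, Q', hQs, hxQ, ⟨hU.1, fun j hj1 hj2 => ?_⟩, hD⟩
  rcases le_total t j with h | h
  · exact hU.2 j h hj2
  · exact diamLE_image_mono (hQ.2 j hj1 h) hQs

lemma Setup.grow_to (S : Setup G N κ) {s t : ℤ} {Q : Set R2} (hQ : Unst G s t Q) (hd : DiamGE ((G ^ t) '' Q) 1)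
    (hst : s + N ≤ t) {x : R2} (hx : x ∈ Q) {t1 : ℤ} (ht1 : t ≤ t1) :
    ∃ t', t1 ≤ t' ∧ t' ≤ t1 + N ∧ ∃ Q' ⊆ Q, x ∈ Q' ∧ Unst G s t' Q' ∧ DiamGE ((G ^ t') '' Q') 1 ∧
      DiamGE ((G ^ t1) '' Q') κ := by
  have key : ∀ n : ℕ, ∃ t', t + n ≤ t' ∧ t' ≤ t + n + N ∧ ∃ Q' ⊆ Q, x ∈ Q' ∧ Unst G s t' Q' ∧ DiamGE ((G ^ t') '' Q') 1 := by
    intro n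
    induction n with
    | zero => exact ⟨t, by simp, by simp, Q, subset_rfl, hx, hQ, hd⟩
    | succ n ih =>
      obtain ⟨t', h1, h2, Q', hs, hx', hU, hD⟩ := ih
      rcases h1.lt_or_eq with h | h
      · exact ⟨t', by push_cast; omega, by push_cast; omega, Q', hs, hx', hU, hD⟩
      · obtain ⟨t'', h1', h2', Q'', hs', hx'', hU', hD'⟩ := S.grow hU hD (by omega) hx'
        exact ⟨t'', by push_cast; omega, by push_cast; omega, Q'', hs'.trans hs, hx'', hU', hD'⟩
  obtain ⟨t', h1, h2, Q', hs, hx', hU, hD⟩ := key (t1 - t).toNat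
  rw [Int.toNat_of_nonneg (by omega)] at h1 h2
  exact ⟨t', by omega, by omega, Q', hs, hx', hU, hD, S.back hD (by omega) (by omega)⟩

lemma Setup.exceed (S : Setup G N κ) {Q : Set R2} (hQ : IsContinuum Q) {s k : ℤ} (hs : DiamLE ((G ^ s) '' Q) κ) (hsk : s ≤ k)
    (hk : ¬ DiamLE ((G ^ k) '' Q) 2) {x : R2} (hx : x ∈ Q) :
    ∃ t, s + N ≤ t ∧ t ≤ k ∧ ∃ Q' ⊆ Q, x ∈ Q' ∧ Unst G s t Q' ∧ DiamGE ((G ^ t) '' Q') 1 := by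
  obtain ⟨t, h1, h2, Q', hQs, hxQ, hU, hD⟩ := first_exceed hQ (hs.mono subset_rfl (by linarith [S.hκ1])) hsk hk hx
  refine ⟨t, ?_, h2, Q', hQs, hxQ, hU, hD⟩
  by_contra hlt
  obtain ⟨p, hp, q, hq, hpq⟩ := hD
  have := S.small hs h1.le (by omega) p (image_mono hQs hp) q (image_mono hQs hq)
  linarith

/-- exceed then grow to time t1 -/
lemma Setup.exceed_to (S : Setup G N κ) {Q : Set R2} (hQ : IsContinuum Q) {s k t1 : ℤ} (hs : DiamLE ((G ^ s) '' Q) κ) (hsk : s ≤ k)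
    (hk : ¬ DiamLE ((G ^ k) '' Q) 2) (hkt : k ≤ t1) {x : R2} (hx : x ∈ Q) :
    ∃ Q' ⊆ Q, x ∈ Q' ∧ Unst G s t1 Q' ∧ DiamGE ((G ^ t1) '' Q') κ := by
  obtain ⟨t, h1, h2, Q', hQs, hxQ, hU, hD⟩ := S.exceed hQ hs hsk hk hx
  obtain ⟨t', h1', h2', Q'', hQs', hxQ', hU', hD', hD''⟩ := S.grow_to hU hD h1 hxQ (h2.trans hkt)
  exact ⟨Q'', hQs'.trans hQs, hxQ', ⟨hU'.1, fun i hi1 hi2 => hU'.2 i hi1 (hi2.trans h1')⟩, hD''⟩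

/-- state used in Lemma S -/
def St (G : R2 ≃ₜ R2) (s t : ℤ) (Q : Set R2) : Prop := Unst G s t Q ∧ DiamGE ((G ^ t) '' Q) 1

lemma Setup.avoid (S : Setup G N κ) {s t : ℤ} {Q : Set R2} (hs0 : 0 ≤ s) (hst : s + N ≤ t) (hQ : St G s t Q)
    {C : Set R2} {R : ℝ} (hR : 0 ≤ R) (hC : ∀ i : ℤ, 0 ≤ i → DiamLE ((G ^ i) '' C) R) :
    ∃ t' ≥ t, ∃ Q' ⊆ Q, St G s t' Q' ∧ Disjoint Q' C := by
  by_contra! hno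
  have h1 : ∀ x ∈ Q, ∀ i ≥ t, ∃ w ∈ C, dist ((G ^ i) x) ((G ^ i) w) ≤ 2 := by
    intro x hx i hi
    obtain ⟨t', ht1, ht2, Q', hQs, hxQ, hU, hD, -⟩ := S.grow_to hQ.1 hQ.2 hst hx hi
    have := hno t' (by omega) Q' hQs ⟨hU, hD⟩
    obtain ⟨w, hw, hwC⟩ := not_disjoint_iff.1 this
    exact ⟨w, hwC, hU.2 i (by omega) ht1 _ ⟨x, hxQ, rfl⟩ _ ⟨w, hw, rfl⟩⟩
  have h2 : ∀ i ≥ t, DiamLE ((G ^ i) '' Q) (R + 4) := by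
    rintro i hi _ ⟨x, hx, rfl⟩ _ ⟨y, hy, rfl⟩
    obtain ⟨w, hw, hxw⟩ := h1 x hx i hi
    obtain ⟨w', hw', hyw⟩ := h1 y hy i hi
    have h3 := hC i (by omega) _ ⟨w, hw, rfl⟩ _ ⟨w', hw', rfl⟩
    have h4 := dist_triangle4_right ((G ^ i) x) ((G ^ i) y) ((G ^ i) w) ((G ^ i) w')
    linarith
  obtain ⟨N', hN'⟩ := unif_exp S.hc S.he S.hκ (R + 4)
  obtain ⟨x, hx⟩ := hQ.1.1.2.nonempty
  obtain ⟨t', ht1, ht2, Q', hQs, hxQ, hU, hD, hD'⟩ := S.grow_to hQ.1 hQ.2 hst hx (t1 := t + N') (by omega)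
  obtain ⟨i, hi, hi2⟩ := hN' _ (hU.1.image (G ^ (t + (N' : ℤ))).continuous) hD'
  rw [← zadd_image] at hi2
  rw [abs_le] at hi
  exact hi2 (diamLE_image_mono (h2 _ (by omega)) hQs)

lemma stableComp_mono {z : R2} {e e' : ℝ} (h : e ≤ e') : stableComp G e z ⊆ stableComp G e' z :=
  connectedComponentIn_mono _ fun _ hx j => (hx j).trans h

lemma stableComp_diam {z : R2} {e : ℝ} (i : ℤ) (hi : 0 ≤ i) : DiamLE ((G ^ i) '' stableComp G e z) (2 * e) := by
  rintro _ ⟨x, hx, rfl⟩ _ ⟨y, hy, rfl⟩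
  have h1 := connectedComponentIn_subset _ _ hx i.toNat
  have h2 := connectedComponentIn_subset _ _ hy i.toNat
  rw [nat_iter_eq, Int.toNat_of_nonneg hi] at h1 h2
  linarith [dist_triangle_right ((G ^ i) x) ((G ^ i) y) ((G ^ i) z)]

lemma Setup.lemS (S : Setup G N κ) {s t : ℤ} {Q : Set R2} {z : R2} (hs0 : 0 ≤ s) (hst : s + N ≤ t) (hQ : St G s t Q) :
    ¬ Q ⊆ stableSet G z := by
  intro hsub
  have step : ∀ (n : ℕ) (p : {p : ℤ × Set R2 // s + N ≤ p.1 ∧ St G s p.1 p.2}),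
      ∃ p' : {p : ℤ × Set R2 // s + N ≤ p.1 ∧ St G s p.1 p.2}, p'.1.2 ⊆ p.1.2 ∧ Disjoint p'.1.2 (stableComp G n z) := by
    rintro n ⟨⟨t, Q⟩, h1, h2⟩
    obtain ⟨t', ht', Q', hQs, hst', hd⟩ := S.avoid hs0 h1 h2 (C := stableComp G n z) (R := 2 * n) (by positivity)
      (fun i hi => stableComp_diam i hi)
    exact ⟨⟨⟨t', Q'⟩, by simp only at h1 ⊢; omega, hst'⟩, hQs, hd⟩
  choose nx hnx1 hnx2 using step
  let q : ℕ → {p : ℤ × Set R2 // s + N ≤ p.1 ∧ St G s p.1 p.2} := fun n =>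
    Nat.rec ⟨(t, Q), hst, hQ⟩ (fun n p => nx n p) n
  have hq : ∀ n, q (n + 1) = nx n (q n) := fun n => rfl
  obtain ⟨x, hx⟩ := IsCompact.nonempty_iInter_of_sequence_nonempty_isCompact_isClosed
    (fun n => (q n).1.2) (fun n => by rw [hq]; exact hnx1 _ _) (fun n => (q n).2.2.1.1.2.nonempty)
    (q 0).2.2.1.1.1 (fun n => (q n).2.2.1.1.1.isClosed)
  rw [mem_iInter] at hx
  have hxs := hsub (hx 0)
  simp only [stableSet, mem_iUnion] at hxs
  obtain ⟨e, he, hxe⟩ := hxs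
  obtain ⟨n, hn⟩ := exists_nat_ge e
  have := hx (n + 1)
  rw [hq] at this
  exact disjoint_left.1 (hnx2 n (q n)) this (stableComp_mono hn hxe)

/-- Base lemma -/
lemma Setup.base (S : Setup G N κ) {Q : Set R2} {z : R2} (hQ : IsContinuum Q) (hsub : Q ⊆ stableSet G z)
    {j : ℤ} (hj : 0 ≤ j) (hd : DiamLE ((G ^ j) '' Q) κ) (i : ℤ) (hi : j ≤ i) : DiamLE ((G ^ i) '' Q) 2 := by
  by_contra hno
  obtain ⟨x, hx⟩ := hQ.2.nonempty
  obtain ⟨t, h1, h2, Q', hQs, hxQ, hU, hD⟩ := S.exceed hQ hd hi hno hx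
  exact S.lemS (z := z) hj h1 ⟨hU, hD⟩ (hQs.trans hsub)

end


/-! ### No stable balls -/

lemma spaced {A : Set R2} (hA : IsPreconnected A) (m : ℕ) {L0 : ℝ} (hL : 0 ≤ L0) (h : DiamGE A (m * L0)) :
    ∃ u : Fin (m + 1) → R2, (∀ k, u k ∈ A) ∧ ∀ k l, k ≠ l → L0 ≤ dist (u k) (u l) := by
  obtain ⟨q, hq, p, hp, hqp⟩ := h
  have hiv : ∀ k : Fin (m + 1), ∃ y ∈ A, dist y p = (k : ℕ) * L0 := by
    intro k
    have := hA.intermediate_value hp hq (f := fun y => dist y p) (by fun_prop)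
    refine this ⟨?_, ?_⟩
    · simp only [dist_self]; positivity
    · refine le_trans ?_ hqp
      have : ((k : ℕ) : ℝ) ≤ m := by exact_mod_cast Nat.lt_succ_iff.1 k.2
      gcongr
  choose u hu hd using hiv
  refine ⟨u, hu, ?_⟩
  have key : ∀ k l : Fin (m + 1), k < l → L0 ≤ dist (u k) (u l) := by
    intro k l hkl
    have h1 := dist_triangle (u l) (u k) p
    rw [hd, hd, dist_comm (u l)] at h1
    have h2 : ((k : ℕ) : ℝ) + 1 ≤ (l : ℕ) := by exact_mod_cast hkl
    nlinarith
  intro k l hkl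
  rcases lt_or_gt_of_ne hkl with h | h
  · exact key k l h
  · rw [dist_comm]; exact key l k h

lemma closedBall_continuum (x : R2) {r : ℝ} (hr : 0 ≤ r) : IsContinuum (closedBall x r) :=
  ⟨isCompact_closedBall _ _, ⟨x, mem_closedBall_self hr⟩, (convex_closedBall _ _).isPreconnected⟩

/-- pigeonhole for fractional parts -/
lemma frac_pigeon {ρ : ℝ} (hρ : 0 < ρ) : ∃ m : ℕ, ∀ u : Fin (m + 1) → R2, ∃ k l, k ≠ l ∧
    dist (u k - tr (flr (u k))) (u l - tr (flr (u l))) ≤ ρ := by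
  obtain ⟨T, -, hT, hcov⟩ := (rect_compact 0 1 0 1).finite_cover_balls (e := ρ / 2) (by linarith)
  have : Finite T := hT
  have : Fintype T := Fintype.ofFinite T
  refine ⟨Fintype.card T, fun u => ?_⟩
  have hc : ∀ k, ∃ y : T, dist (u k - tr (flr (u k))) y < ρ / 2 := by
    intro k
    have := hcov (flr_mem (u k))
    simp only [mem_iUnion, mem_ball] at this
    obtain ⟨y, hy, h⟩ := this
    exact ⟨⟨y, hy⟩, h⟩
  choose f hf using hc
  obtain ⟨k, l, hkl, he⟩ := Fintype.exists_ne_map_eq_of_card_lt f (by simp)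
  refine ⟨k, l, hkl, ?_⟩
  have h1 := hf k
  have h2 := hf l
  rw [← he] at h2
  linarith [dist_triangle_right (u k - tr (flr (u k))) (u l - tr (flr (u l))) (f k : R2)]

section
variable {G : R2 ≃ₜ R2} {N : ℕ} {κ : ℝ}

lemma zneg (n : ℤ) (x : R2) : (G ^ n) ((G ^ (-n)) x) = x := by
  rw [← zadd]; simp

lemma zneg' (n : ℤ) (x : R2) : (G ^ (-n)) ((G ^ n) x) = x := by
  rw [← zadd]; simp

lemma zneg_image (n : ℤ) (S : Set R2) : (G ^ (-n)) '' ((G ^ n) '' S) = S := by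
  rw [← zadd_image, neg_add_cancel, z0_image]

lemma zneg_image' (n : ℤ) (S : Set R2) : (G ^ n) '' ((G ^ (-n)) '' S) = S := by
  rw [← zadd_image, add_neg_cancel, z0_image]

lemma Setup.ns (S : Setup G N κ) (x : R2) {r : ℝ} (hr : 0 < r) :
    ∃ i : ℤ, 0 ≤ i ∧ ¬ DiamLE ((G ^ i) '' closedBall x r) 2 := by
  by_contra! hno
  have hκ := S.hκ
  let δ := min (r / 2) (κ / 2)
  have hδ : 0 < δ := by simp only [δ]; positivity
  obtain ⟨n1, hn1⟩ := unif_exp S.hc S.he hδ 2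
  have hi : ∀ n : ℕ, n1 ≤ n → ∀ u ∈ closedBall x (r / 2),
      DiamLE ((G ^ (n : ℤ)) '' closedBall ((G ^ (-(n : ℤ))) u) (κ / 2)) 2 := by
    intro n hn u hu
    by_contra hbad
    set W := (G ^ (n : ℤ)) '' closedBall ((G ^ (-(n : ℤ))) u) (κ / 2) with hW
    have hWc : IsContinuum W := (closedBall_continuum _ (by linarith)).image (G ^ (n : ℤ)).continuous
    have hWs : DiamLE ((G ^ (-(n : ℤ))) '' W) κ := by
      rw [hW, zneg_image]; exact diamLE_closedBall.mono subset_rfl (by linarith)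
    have huW : u ∈ W := ⟨_, mem_closedBall_self (by linarith), zneg _ _⟩
    obtain ⟨Q', hQs, huQ, hU, hD⟩ := S.exceed_to hWc (k := 0) (t1 := 0) hWs (by omega) (by rwa [z0_image]) le_rfl huW
    rw [z0_image] at hD
    obtain ⟨C, hCs, hC, huC, hCb, hCd⟩ := cut_piece hU.1 huQ hδ (hD.mono subset_rfl (by
      have : δ ≤ κ / 2 := min_le_right _ _
      linarith))
    obtain ⟨i, hi, hi2⟩ := hn1 C hC hCd
    rw [abs_le] at hi
    rcases le_total 0 i with h | h
    · refine hi2 (diamLE_image_mono (hno i h) (hCb.trans ?_))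
      refine closedBall_subset_closedBall' ?_
      rw [mem_closedBall] at hu
      have : δ ≤ r / 2 := min_le_left _ _
      linarith
    · exact hi2 (diamLE_image_mono (hU.2 i (by omega) h) hCs)
  obtain ⟨m, hm⟩ := frac_pigeon (ρ := κ / 2) (by linarith)
  set L0 := 3 + r + κ / 2 with hL0
  have hM : ∀ n : ℕ, n1 ≤ n → DiamLE ((G ^ (-(n : ℤ))) '' closedBall x (r / 2)) (m * L0) := by
    intro n hn
    by_contra hbad
    have hSc := (closedBall_continuum x (r := r / 2) (by linarith)).image (G ^ (-(n : ℤ))).continuous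
    obtain ⟨u, huS, hu⟩ := spaced hSc.2.isPreconnected m (L0 := L0) (by positivity) (not_diamLE_GE hbad)
    obtain ⟨k, l, hkl, hd⟩ := hm u
    obtain ⟨a, ha, hak⟩ := huS k
    obtain ⟨b, hb, hbl⟩ := huS l
    set v := flr (u k) - flr (u l) with hv
    have hvk : tr (flr (u k)) = tr v + tr (flr (u l)) := by rw [← tr_add, hv, sub_add_cancel]
    have h1 : dist (u l + tr v) (u k) ≤ κ / 2 := by
      rw [dist_comm]
      have e : dist (u k) (u l + tr v) = dist (u k - tr (flr (u k))) (u l - tr (flr (u l))) := by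
        rw [hvk, dist_eq_norm, dist_eq_norm]; congr 1; abel
      rw [e]; exact hd
    have h2 := hi n hn a ha
    rw [hak] at h2
    have h3 := h2 ((G ^ (n : ℤ)) (u l + tr v)) ⟨_, h1, rfl⟩ ((G ^ (n : ℤ)) (u k))
      ⟨_, mem_closedBall_self (by linarith), rfl⟩
    rw [comm_zpow S.hc n, ← hak, ← hbl, zneg, zneg] at h3
    have h4 : dist a b ≤ r := by
      have := diamLE_closedBall a ha b hb
      linarith
    have h5 : ‖tr v‖ ≤ 2 + r := by
      have e : tr v = (b + tr v - a) + (a - b) := by abel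
      rw [e]
      refine (norm_add_le _ _).trans ?_
      rw [← dist_eq_norm, ← dist_eq_norm]
      linarith
    have h6 : dist (u k) (u l) ≤ κ / 2 + ‖tr v‖ := by
      have e : u k - u l = (u k - (u l + tr v)) + tr v := by abel
      rw [dist_eq_norm, e]
      refine (norm_add_le _ _).trans ?_
      rw [← dist_eq_norm, dist_comm]
      linarith
    have := hu k l hkl
    linarith
  obtain ⟨C, hC0, hC⟩ := comm_disp S.hc
  have hall : ∀ i : ℤ, DiamLE ((G ^ i) '' closedBall x (r / 2)) (2 + m * L0 + (r + 2 * (C * n1))) := by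
    have p1 : 0 ≤ m * L0 := by positivity
    have p2 : 0 ≤ r + 2 * (C * n1) := by positivity
    intro i
    rcases le_total 0 i with h | h
    · exact (hno i h).mono (image_mono (closedBall_subset_closedBall (by linarith))) (by linarith)
    obtain ⟨n, rfl⟩ : ∃ n : ℕ, i = -(n : ℤ) := ⟨(-i).toNat, by omega⟩
    rcases le_total n1 n with h' | h'
    · exact (hM n h').mono subset_rfl (by linarith)
    · rintro _ ⟨a, ha, rfl⟩ _ ⟨b, hb, rfl⟩
      have e1 := disp_nat hC n ((G ^ (-(n : ℤ))) a)
      have e2 := disp_nat hC n ((G ^ (-(n : ℤ))) b)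
      rw [zneg] at e1 e2
      have e3 := diamLE_closedBall a ha b hb
      have e4 : C * n ≤ C * n1 := by gcongr
      rw [dist_comm] at e1
      have := dist_triangle4 ((G ^ (-(n : ℤ))) a) a b ((G ^ (-(n : ℤ))) b)
      linarith
  have := S.he _ (closedBall_continuum x (by linarith)) _ hall x (mem_closedBall_self (by linarith))
    (x + (r / 2, 0)) (by
      rw [mem_closedBall, dist_eq_norm, add_sub_cancel_left, Prod.norm_def]
      simp [abs_of_pos hr]; linarith)
  have := congrArg Prod.fst this
  simp at this
  linarith

lemma trS_ball (v : ℤ × ℤ) (x : R2) (r : ℝ) : trS v (closedBall x r) = closedBall (x + tr v) r := by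
  ext y
  simp only [trS, mem_image, mem_closedBall]
  constructor
  · rintro ⟨z, hz, rfl⟩
    rwa [dist_add_right]
  · intro h
    refine ⟨y - tr v, ?_, by abel⟩
    rw [dist_eq_norm] at h ⊢
    convert h using 2
    abel

lemma Setup.uns (S : Setup G N κ) {r : ℝ} (hr : 0 < r) :
    ∃ Nr : ℕ, ∀ x, ∃ k : ℤ, 0 ≤ k ∧ k ≤ Nr ∧ ¬ DiamLE ((G ^ k) '' closedBall x r) 2 := by
  have hcp : ∃ Nr : ℕ, ∀ x ∈ Rect 0 1 0 1, ∃ k : ℤ, 0 ≤ k ∧ k ≤ Nr ∧ ¬ DiamLE ((G ^ k) '' closedBall x r) 2 := by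
    refine (rect_compact 0 1 0 1).induction_on (p := fun T => ∃ Nr : ℕ, ∀ x ∈ T, ∃ k : ℤ, 0 ≤ k ∧ k ≤ Nr ∧
      ¬ DiamLE ((G ^ k) '' closedBall x r) 2) ⟨0, by simp⟩ ?_ ?_ ?_
    · rintro s t hst ⟨n, hn⟩
      exact ⟨n, fun x hx => hn x (hst hx)⟩
    · rintro s t ⟨n, hn⟩ ⟨n', hn'⟩
      refine ⟨max n n', ?_⟩
      rintro x (hx | hx)
      · obtain ⟨k, h1, h2, h3⟩ := hn x hx
        exact ⟨k, h1, by push_cast; omega, h3⟩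
      · obtain ⟨k, h1, h2, h3⟩ := hn' x hx
        exact ⟨k, h1, by push_cast; omega, h3⟩
    · intro y hy
      obtain ⟨k, hk0, hk⟩ := S.ns y (r := r / 2) (by linarith)
      refine ⟨ball y (r / 2), mem_nhdsWithin_of_mem_nhds (ball_mem_nhds y (by linarith)), k.toNat, fun x hx => ?_⟩
      refine ⟨k, hk0, by omega, fun hd => hk (diamLE_image_mono hd (closedBall_subset_closedBall' ?_))⟩
      rw [mem_ball, dist_comm] at hx
      linarith
  obtain ⟨Nr, hNr⟩ := hcp
  refine ⟨Nr, fun x => ?_⟩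
  obtain ⟨k, h1, h2, h3⟩ := hNr _ (flr_mem x)
  refine ⟨k, h1, h2, fun hd => h3 ?_⟩
  have e : closedBall (x - tr (flr x)) r = trS (-flr x) (closedBall x r) := by
    rw [trS_ball]; congr 1; simp [tr, sub_eq_add_neg]
  rw [e, trS_image (comm_zpow S.hc k)]
  exact trS_diamLE hd

end


/-- The identity or the coordinate swap. -/
def sw (o : Bool) : R2 ≃ₜ R2 := if o then Homeomorph.prodComm ℝ ℝ else Homeomorph.refl R2

lemma sw_true (p : R2) : sw true p = (p.2, p.1) := rfl
lemma sw_false (p : R2) : sw false p = p := rfl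

lemma sw_dist (o : Bool) (p q : R2) : dist (sw o p) (sw o q) = dist p q := by
  cases o
  · rfl
  · rw [sw_true, sw_true, Prod.dist_eq, Prod.dist_eq, max_comm]

lemma sw_sw (o : Bool) (p : R2) : sw o (sw o p) = p := by
  cases o <;> rfl

lemma sw_image_image (o : Bool) (P : Set R2) : sw o '' (sw o '' P) = P := by
  rw [image_image]; simp [sw_sw]

lemma planar_sw (o : Bool) {a b c d : ℝ} (hab : a < b) (hcd : c < d) {P P' : Set R2}
    (hP : Cross a b c d (sw o '' P)) (hP' : Cross a b c d (sw o '' P')) (h : R2 ≃ₜ R2)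
    (hfar : ∀ p ∈ P, ∀ p' ∈ P', 2 < dist (h p) (h p')) (Γ : Set R2) (hΓ : Γ ⊆ Rect a b c d) {ε : ℝ}
    (hε : 0 < ε) (hnet : ∀ y ∈ Rect a b c d, ∃ q ∈ Γ, dist q y ≤ ε)
    (hpat : ∀ q ∈ Γ, q ∈ Dn a b c d (sw o '' P) ↔ q ∈ Dn a b c d (sw o '' P')) {r : ℝ} (hr : 0 < r) (hr4 : r ≤ 1 / 4) :
    ∃ C, IsContinuum C ∧ (∀ y ∈ C, ∃ p ∈ P ∪ P', dist y p ≤ ε) ∧ DiamLE (h '' C) (2 * r) ∧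
      (DiamGE C (b - a) ∨ ∃ q, h '' C = closedBall q (r / 4)) := by
  obtain ⟨C, h1, h2, h3, h4⟩ := planar hab hcd hP hP' ((sw o).trans h) (by
    rintro _ ⟨p, hp, rfl⟩ _ ⟨p', hp', rfl⟩
    simp only [Homeomorph.trans_apply, sw_sw]
    exact hfar p hp p' hp') Γ hΓ hε hnet hpat hr hr4
  have e : ((sw o).trans h) '' C = h '' (sw o '' C) := by
    rw [image_image]; rfl
  rw [e] at h3 h4
  refine ⟨sw o '' C, h1.image (sw o).continuous, ?_, h3, h4.imp ?_ id⟩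
  · rintro _ ⟨y, hy, rfl⟩
    obtain ⟨p, hp, hd⟩ := h2 y hy
    refine ⟨sw o p, ?_, by rwa [sw_dist]⟩
    rcases hp with ⟨q, hq, rfl⟩ | ⟨q, hq, rfl⟩
    · left; rwa [sw_sw]
    · right; rwa [sw_sw]
  · rintro ⟨x, hx, y, hy, hxy⟩
    exact ⟨_, ⟨x, hx, rfl⟩, _, ⟨y, hy, rfl⟩, by rwa [sw_dist]⟩

lemma cross_exists {A : Set R2} (hA : IsContinuum A) (hs : A ⊆ Rect (-1) 2 (-1) 2) {a : ℝ} (ha : 0 < a)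
    (hd : DiamGE A (4 * a)) :
    ∃ (o : Bool) (i : ℕ), (i : ℝ) * a ≤ 4 ∧ ∃ P ⊆ A, IsContinuum P ∧
      Cross (-1 + i * a) (-1 + (i + 1) * a) (-2) 3 (sw o '' P) := by
  obtain ⟨x, hx, y, hy, hxy⟩ := hd
  have key : ∃ o : Bool, ∃ u ∈ A, ∃ v ∈ A, (sw o u).1 + 4 * a ≤ (sw o v).1 := by
    rw [Prod.dist_eq, le_max_iff, Real.dist_eq, Real.dist_eq, le_abs, le_abs] at hxy
    rcases hxy with (h | h) | (h | h)
    · exact ⟨false, y, hy, x, hx, by simp only [sw_false]; linarith⟩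
    · exact ⟨false, x, hx, y, hy, by simp only [sw_false]; linarith⟩
    · exact ⟨true, y, hy, x, hx, by simp only [sw_true]; linarith⟩
    · exact ⟨true, x, hx, y, hy, by simp only [sw_true]; linarith⟩
  obtain ⟨o, u, hu, v, hv, huv⟩ := key
  have hbox : ∀ p ∈ A, (-1 ≤ (sw o p).1 ∧ (sw o p).1 ≤ 2) ∧ (-1 ≤ (sw o p).2 ∧ (sw o p).2 ≤ 2) := by
    intro p hp
    obtain ⟨⟨h1, h2⟩, h3, h4⟩ := hs hp
    cases o
    · exact ⟨⟨h1, h2⟩, h3, h4⟩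
    · exact ⟨⟨h3, h4⟩, h1, h2⟩
  set i := ⌈((sw o u).1 + 1) / a⌉₊ with hi
  have hnn : 0 ≤ ((sw o u).1 + 1) / a := div_nonneg (by linarith [(hbox u hu).1.1]) ha.le
  have h1 : (sw o u).1 + 1 ≤ i * a := by
    have := Nat.le_ceil (((sw o u).1 + 1) / a)
    rwa [div_le_iff₀ ha] at this
  have h2 : i * a < (sw o u).1 + 1 + a := by
    have := Nat.ceil_lt_add_one hnn
    rw [← hi] at this
    have := mul_lt_mul_of_pos_right this ha
    rwa [add_mul, div_mul_cancel₀ _ ha.ne', one_mul] at this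
  have hvb := (hbox v hv).1.2
  have hub := (hbox u hu).1.1
  obtain ⟨P, hPA, hP, hPr, ⟨p, hp, hpe⟩, q, hq, hqe⟩ := cut hA (fun p => (sw o p).1)
    ((continuous_fst).comp (sw o).continuous) (α := -1 + i * a) (β := -1 + (i + 1) * a) (by linarith)
    ⟨u, hu, by linarith⟩ ⟨v, hv, by linarith⟩
  refine ⟨o, i, by linarith, P, hPA, hP, hP.image (sw o).continuous, ?_, ?_, ?_, ?_⟩
  · rintro _ ⟨w, hw, rfl⟩
    have := hbox w (hPA hw)
    exact ⟨hPr w hw, by linarith [this.2.1], by linarith [this.2.2]⟩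
  · rintro _ ⟨w, hw, rfl⟩
    have := hbox w (hPA hw)
    exact ⟨by linarith [this.2.1], by linarith [this.2.2]⟩
  · exact ⟨_, ⟨p, hp, rfl⟩, hpe⟩
  · exact ⟨_, ⟨q, hq, rfl⟩, hqe⟩

lemma diam12 {B P P' : Set R2} (hB : IsPreconnected B) (hP : P.Nonempty) (hP' : P'.Nonempty)
    (h2 : DiamLE P 2) (h2' : DiamLE P' 2) (hn : ∀ y ∈ B, ∃ p ∈ P ∪ P', dist y p ≤ 1) : DiamLE B 12 := by
  obtain ⟨p, hp⟩ := hP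
  obtain ⟨p', hp'⟩ := hP'
  have hcov : B ⊆ closedBall p 3 ∪ closedBall p' 3 := by
    intro y hy
    obtain ⟨q, hq | hq, hd⟩ := hn y hy
    · left
      have := h2 q hq p hp
      rw [mem_closedBall]
      linarith [dist_triangle y q p]
    · right
      have := h2' q hq p' hp'
      rw [mem_closedBall]
      linarith [dist_triangle y q p']
  have mixed : ∀ x ∈ B, ∀ y ∈ B, x ∈ closedBall p 3 → y ∈ closedBall p' 3 → dist x y ≤ 12 := by
    intro x hx y hy h h'
    obtain ⟨w, _, hw, hw'⟩ := isPreconnected_closed_iff.1 hB _ _ isClosed_closedBall isClosed_closedBall hcov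
      ⟨x, hx, h⟩ ⟨y, hy, h'⟩
    have e1 := diamLE_closedBall x h w hw
    have e2 := diamLE_closedBall w hw' y h'
    linarith [dist_triangle x w y]
  intro x hx y hy
  rcases hcov hx with h | h <;> rcases hcov hy with h' | h'
  · linarith [diamLE_closedBall x h y h']
  · exact mixed x hx y hy h h'
  · rw [dist_comm]; exact mixed y hy x hx h' h
  · linarith [diamLE_closedBall x h y h']

section
variable {G : R2 ≃ₜ R2} {N : ℕ} {κ : ℝ}

lemma Setup.finish (S : Setup G N κ) {a ε r : ℝ} {T Nr : ℕ} {j : ℤ}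
    (hT : ∀ A, IsContinuum A → DiamGE A (min a κ) → ∃ i : ℤ, |i| ≤ (T : ℤ) ∧ ¬ DiamLE ((G ^ i) '' A) 12)
    (hε : ∀ x y, dist x y ≤ ε → ∀ i : ℤ, 0 ≤ i → i ≤ T → dist ((G ^ i) x) ((G ^ i) y) ≤ 1)
    (h2r : 2 * r ≤ κ) (hNr : ∀ x, ∃ k : ℤ, 0 ≤ k ∧ k ≤ Nr ∧ ¬ DiamLE ((G ^ k) '' closedBall x (r / 4)) 2)
    (hTj : T ≤ j) (hNj : Nr ≤ j) {P P' : Set R2} (hP : P.Nonempty) (hP' : P'.Nonempty)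
    (hf : ∀ i : ℤ, 0 ≤ i → DiamLE ((G ^ i) '' P) 2) (hf' : ∀ i : ℤ, 0 ≤ i → DiamLE ((G ^ i) '' P') 2)
    {C : Set R2} (hC : IsContinuum C) (hn : ∀ y ∈ C, ∃ p ∈ P ∪ P', dist y p ≤ ε)
    (hd : DiamLE ((G ^ (-j)) '' C) (2 * r))
    (hor : DiamGE C a ∨ ∃ q, (G ^ (-j)) '' C = closedBall q (r / 4)) : False := by
  have hB : ∃ B ⊆ C, IsContinuum B ∧ DiamGE B (min a κ) ∧
      ∀ i : ℤ, 0 ≤ i → i ≤ j → DiamLE ((G ^ (-i)) '' B) 2 := by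
    by_cases hk : ∃ k : ℤ, 0 ≤ k ∧ k ≤ j ∧ ¬ DiamLE ((G ^ k) '' ((G ^ (-j)) '' C)) 2
    · obtain ⟨k, h0, hkj, hk⟩ := hk
      obtain ⟨x, hx⟩ := hC.2.1
      obtain ⟨Q', hQ', -, hU, hG⟩ := S.exceed_to (Q := (G ^ (-j)) '' C) (s := 0) (t1 := j)
        (hC.image (G ^ (-j)).continuous)
        (by rw [z0_image]; exact hd.mono subset_rfl h2r) h0 hk hkj (mem_image_of_mem _ hx)
      refine ⟨(G ^ j) '' Q', ?_, hU.1.image (G ^ j).continuous, hG.mono subset_rfl (min_le_right _ _), ?_⟩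
      · refine (image_mono hQ').trans ?_
        rw [zneg_image']
      · intro i h1 h2
        rw [← zadd_image]
        exact hU.2 _ (by omega) (by omega)
    · push Not at hk
      rcases hor with hor | ⟨q, hq⟩
      · refine ⟨C, subset_rfl, hC, hor.mono subset_rfl (min_le_left _ _), fun i h1 h2 => ?_⟩
        have := hk (j - i) (by omega) (by omega)
        rw [← zadd_image] at this
        convert this using 4
        omega
      · exfalso
        obtain ⟨k, h0, h1, h2⟩ := hNr q
        rw [← hq] at h2
        exact h2 (hk k h0 (by omega))
  obtain ⟨B, hBC, hB, hBd, hpast⟩ := hB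
  obtain ⟨i, hi, hni⟩ := hT B hB hBd
  apply hni
  rw [abs_le] at hi
  rcases le_total 0 i with h0 | h0
  · refine diam12 (hB.image (G ^ i).continuous).2.isPreconnected (hP.image (G ^ i)) (hP'.image (G ^ i))
      (hf i h0) (hf' i h0) ?_
    rintro _ ⟨y, hy, rfl⟩
    obtain ⟨p, hp, hpd⟩ := hn y (hBC hy)
    refine ⟨(G ^ i) p, ?_, hε _ _ hpd i h0 hi.2⟩
    rw [← image_union]
    exact mem_image_of_mem _ hp
  · have := hpast (-i) (by omega) (by omega)
    rw [neg_neg] at this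
    exact this.mono subset_rfl (by norm_num)

end


section
variable {G : R2 ≃ₜ R2} {N : ℕ} {κ : ℝ}

/-- The piece attached to a point of `G^j K`. -/
lemma Setup.piece (S : Setup G N κ) {d : ℝ} {z : R2} {K : Set R2} (hK : IsContinuum K) (hs : K ⊆ stableSet G z)
    {j : ℤ} (hj : 0 ≤ j) (hbig : DiamGE ((G ^ j) '' K) κ) (p : R2) (hp : p ∈ (G ^ j) '' K) :
    ∃ (o : Bool) (i : ℕ), (i : ℝ) * (κ / 8) ≤ 4 ∧ ∃ P : Set R2,
      Cross (-1 + i * (κ / 8)) (-1 + (i + 1) * (κ / 8)) (-2) 3 (sw o '' P) ∧ P.Nonempty ∧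
      (∀ i : ℤ, 0 ≤ i → DiamLE ((G ^ i) '' P) 2) ∧
      ∀ q ∈ P, ∃ x ∈ K, (G ^ (-j)) q = x + tr (-flr p) := by
  have hκ := S.hκ
  have hκ1 := S.hκ1
  obtain ⟨A, hAsub, hA, hpA, hball, hge⟩ := cut_piece (hK.image (G ^ j).continuous) hp (r := κ / 2) (by linarith)
    (hbig.mono subset_rfl (by linarith))
  have hfut : ∀ i : ℤ, 0 ≤ i → DiamLE ((G ^ i) '' A) 2 := by
    intro i hi
    have := S.base (Q := (G ^ (-j)) '' A) (z := z) (j := j) (hA.image (G ^ (-j)).continuous)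
      (by
        refine ((image_mono hAsub).trans ?_).trans hs
        rw [zneg_image]) hj
      (by
        rw [zneg_image']
        exact diamLE_closedBall.mono hball (by linarith)) (i + j) (by omega)
    rw [← zadd_image] at this
    convert this using 4
    omega
  have hA' := trS_cont (v := -flr p) hA
  have hcm := fun i => comm_zpow S.hc i
  obtain ⟨o, i, hi, P, hPA, hPc, hcr⟩ := cross_exists hA' (a := κ / 8) (by
    rintro _ ⟨x, hx, rfl⟩
    have h1 := mem_closedBall.1 (hball hx)
    obtain ⟨⟨h2, h3⟩, h4, h5⟩ := flr_mem p
    rw [Prod.dist_eq, max_le_iff, Real.dist_eq, Real.dist_eq, abs_le, abs_le] at h1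
    simp only [tr, Prod.fst_sub, Prod.snd_sub] at h2 h3 h4 h5
    simp only [Rect, mem_prod, mem_Icc, tr, Prod.fst_add, Prod.snd_add, Prod.fst_neg, Prod.snd_neg, Int.cast_neg]
    refine ⟨⟨?_, ?_⟩, ?_, ?_⟩ <;> linarith [h1.1.1, h1.1.2, h1.2.1, h1.2.2]) (by linarith)
    (trS_diamGE (hge.mono subset_rfl (by linarith)))
  refine ⟨o, i, hi, P, hcr, hPc.2.1, ?_, ?_⟩
  · intro i hi
    refine diamLE_image_mono ?_ hPA
    rw [trS_image (hcm i)]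
    exact trS_diamLE (hfut i hi)
  · intro q hq
    obtain ⟨x, hx, rfl⟩ := hPA hq
    obtain ⟨y, hy, rfl⟩ := hAsub hx
    refine ⟨y, hy, ?_⟩
    show (G ^ (-j)) ((G ^ j) y + tr (-flr p)) = _
    rw [hcm (-j), zneg']

lemma far_of (p p' x x' : R2) {d : ℝ} (hp : d + 6 ≤ dist p p') (hx : dist x x' ≤ d) :
    2 < dist (x + tr (-flr p)) (x' + tr (-flr p')) := by
  obtain ⟨⟨h2, h3⟩, h4, h5⟩ := flr_mem p
  obtain ⟨⟨k2, k3⟩, k4, k5⟩ := flr_mem p'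
  by_contra hcon
  push Not at hcon
  rw [Prod.dist_eq, max_le_iff, Real.dist_eq, Real.dist_eq, abs_le, abs_le] at hcon hx
  rw [Prod.dist_eq, le_max_iff, Real.dist_eq, Real.dist_eq, le_abs, le_abs] at hp
  simp only [tr, Prod.fst_sub, Prod.snd_sub, Prod.fst_add, Prod.snd_add, Prod.fst_neg, Prod.snd_neg, Int.cast_neg] at *
  obtain ⟨⟨c1, c2⟩, c3, c4⟩ := hcon
  obtain ⟨⟨e1, e2⟩, e3, e4⟩ := hx
  rcases hp with (h | h) | (h | h) <;> linarith

lemma Setup.large (S : Setup G N κ) {d : ℝ} (hd : 0 < d) :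
    ∃ (J0 : ℕ) (L : ℝ), 0 ≤ L ∧ ∀ (z : R2) (K : Set R2), IsContinuum K → K ⊆ stableSet G z → DiamLE K d →
      ∀ j : ℤ, J0 ≤ j → DiamLE ((G ^ j) '' K) L := by
  have hκ := S.hκ
  have hκ1 := S.hκ1
  obtain ⟨T, hT⟩ := unif_exp S.hc S.he (δ := min (κ / 8) κ) (lt_min (by linarith) hκ) 12
  obtain ⟨ε, hε, -, hεT⟩ := unif_upto S.hc T (ε := 1) one_pos
  obtain ⟨Nr, hNr⟩ := S.uns (r := (κ / 2) / 4) (by linarith)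
  have hnet : ∀ i : ℕ, ∃ t ⊆ Rect (-1 + i * (κ / 8)) (-1 + (i + 1) * (κ / 8)) (-2) 3, t.Finite ∧
      ∀ y ∈ Rect (-1 + i * (κ / 8)) (-1 + (i + 1) * (κ / 8)) (-2) 3, ∃ q ∈ t, dist q y ≤ ε := by
    intro i
    obtain ⟨t, h1, h2, h3⟩ := (rect_compact (-1 + i * (κ / 8)) (-1 + (i + 1) * (κ / 8)) (-2) 3).finite_cover_balls hε
    refine ⟨t, h1, h2, fun y hy => ?_⟩
    obtain ⟨q, hq, hy⟩ := mem_iUnion₂.1 (h3 hy)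
    rw [mem_ball, dist_comm] at hy
    exact ⟨q, hq, hy.le⟩
  choose Γ hΓs hΓf hΓn using hnet
  obtain ⟨M, hM⟩ := exists_nat_gt (4 / (κ / 8))
  have hΓall : (⋃ i : Fin M, Γ i).Finite := finite_iUnion fun i => hΓf i
  have : Finite (⋃ i : Fin M, Γ i) := hΓall
  let τ := Bool × Fin M × Set (⋃ i : Fin M, Γ i)
  have hτ : Finite τ := inferInstance
  let m := Nat.card τ
  refine ⟨max T Nr, m * (d + 6) + 1, by positivity, fun z K hK hs hKd j hj => ?_⟩
  push_cast at hj
  have hTj : (T : ℤ) ≤ j := (le_max_left _ _).trans hj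
  have hNj : (Nr : ℤ) ≤ j := (le_max_right _ _).trans hj
  by_contra hcon
  have hGE := not_diamLE_GE hcon
  have hm0 : (0 : ℝ) ≤ m * (d + 6) := by positivity
  have hAc := hK.image (G ^ j).continuous
  obtain ⟨u, huA, hud⟩ := spaced hAc.2.isPreconnected m (L0 := d + 6) (by linarith)
    (hGE.mono subset_rfl (by linarith))
  have hpc := fun k => S.piece (d := d) hK hs (by omega) (hGE.mono subset_rfl (by linarith)) (u k) (huA k)
  choose o i hi P hcr hne hfu hbk using hpc
  have hiM : ∀ k, i k < M := by
    intro k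
    have : (i k : ℝ) ≤ 4 / (κ / 8) := by rw [le_div_iff₀ (by linarith)]; exact hi k
    exact_mod_cast this.trans_lt hM
  let φ : Fin (m + 1) → τ := fun k => (o k, ⟨i k, hiM k⟩,
    {q | q.1 ∈ Dn (-1 + i k * (κ / 8)) (-1 + (i k + 1) * (κ / 8)) (-2) 3 (sw (o k) '' P k)})
  have hninj : ¬ Function.Injective φ := by
    intro h
    have := Nat.card_le_card_of_injective φ h
    rw [Nat.card_fin] at this
    change m + 1 ≤ m at this
    omega
  simp only [Function.Injective, not_forall] at hninj
  obtain ⟨k, l, hkl, hne'⟩ := hninj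
  have ho : o k = o l := congrArg (fun t : τ => t.1) hkl
  have hii : i k = i l := congrArg (fun t : τ => (t.2.1 : ℕ)) hkl
  have hpat := congrArg (fun t : τ => t.2.2) hkl
  simp only [φ] at hpat
  have hcrk := hcr k
  have hcrl := hcr l
  rw [← ho, ← hii] at hcrl
  rw [← ho, ← hii] at hpat
  obtain ⟨C, hC, hCn, hCd, hCor⟩ := planar_sw (o k) (by nlinarith) (by norm_num) hcrk hcrl (G ^ (-j))
    (by
      intro p hp p' hp'
      obtain ⟨x, hx, e⟩ := hbk k p hp
      obtain ⟨x', hx', e'⟩ := hbk l p' hp'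
      rw [e, e']
      exact far_of _ _ _ _ (hud k l hne') (hKd x hx x' hx')) (Γ (i k)) (hΓs _) hε (hΓn _)
    (by
      intro q hq
      have := Set.ext_iff.1 hpat ⟨q, mem_iUnion.2 ⟨⟨i k, hiM k⟩, hq⟩⟩
      exact this) (r := κ / 2) (by linarith) (by linarith)
  refine S.finish hT hεT (by linarith) hNr hTj hNj (hne k) (hne l) (hfu k) (hfu l) hC hCn hCd
    (hCor.imp_left fun h => h.mono subset_rfl (by linarith))

end

lemma diamLE_iff_ediam {S : Set R2} {c : ℝ} (hc : 0 ≤ c) : EMetric.diam S ≤ ENNReal.ofReal c ↔ DiamLE S c := by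
  constructor
  · intro h x hx y hy
    have := (Metric.edist_le_ediam_of_mem hx hy).trans h
    rwa [edist_dist, ENNReal.ofReal_le_ofReal_iff hc] at this
  · intro h
    refine Metric.ediam_le fun x hx y hy => ?_
    rw [edist_dist]
    exact ENNReal.ofReal_le_ofReal (h x hx y hy)

/-- Small stable continua cannot grow much in the future: there is `L_d` such that any
stable continuum of diameter at most `d` has all its future iterates of diameter
at most `L_d`. -/
theorem small_stable_continua_bounded_future
    (g : Torus ≃ₜ Torus) (G : R2 ≃ₜ R2) (hG : IsLiftFun ⇑g ⇑G)
    (hrot : (interior (rotSet G)).Nonempty)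
    (hexp : ∀ K : Set R2, IsContinuum K → K.Nontrivial → dynDiam G K = ⊤)
    (d : ℝ) (hd : 0 < d) :
    ∃ L : ℝ, 0 < L ∧ ∀ (z : R2) (K : Set R2), IsContinuum K → K ⊆ stableSet G z →
      EMetric.diam K ≤ ENNReal.ofReal d →
      ∀ j : ℤ, 0 < j → EMetric.diam (iterZ G j '' K) ≤ ENNReal.ofReal L := by
  have hc : Comm G := hG.2
  obtain ⟨N, κ, S⟩ := exists_setup hc (expd_of G hexp)
  obtain ⟨J0, L, hL, hbig⟩ := S.large hd
  obtain ⟨C, hC, hCd⟩ := comm_disp hc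
  refine ⟨L + d + 2 * (C * J0), by positivity, fun z K hK hs hKd j hj => ?_⟩
  rw [diamLE_iff_ediam hd.le] at hKd
  have h0 : 0 ≤ C * J0 := by positivity
  rw [iterZ_eq, diamLE_iff_ediam (by positivity)]
  by_cases hjJ : (J0 : ℤ) ≤ j
  · exact (hbig z K hK hs hKd j hjJ).mono subset_rfl (by linarith)
  · rintro _ ⟨x, hx, rfl⟩ _ ⟨y, hy, rfl⟩
    lift j to ℕ using hj.le
    have hle : (j : ℝ) ≤ J0 := by
      have : j ≤ J0 := by omega
      exact_mod_cast this
    have h1 := disp_nat hCd j x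
    have h2 := disp_nat hCd j y
    have h3 := hKd x hx y hy
    have h4 : C * j ≤ C * J0 := by gcongr
    rw [dist_comm] at h2
    have := dist_triangle4 ((G ^ (j : ℤ)) x) x y ((G ^ (j : ℤ)) y)
    linarith
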